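/- Assume the abc conjecture. Let n ≥ 2 be an integer and let f ∈ ℤ[X] be squarefree (in ℚ[X]) and weakly intersective, with no root in ℚ, and with deg f > 5 and deg f > (4n−2)/(n−1). Then there exist c > 0 and X₀ such that for all real X ≥ X₀, the number of n-th power free integers d with |d| ≤ X for which the twist C_d : d·y^n = f(x) violates the Hasse principle is at least c·X. -/

import Mathlib

open Polynomial

/-- The radical of an integer: the product of its distinct prime factors. -/
def IntRadical (m : ℤ) : ℕ := ∏ p ∈ m.natAbs.primeFactors, p

/-- The abc conjecture of Masser–Oesterlé. -/
def ABCConjecture : Prop :=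
  ∀ ε : ℝ, 0 < ε → ∃ K : ℝ, 0 < K ∧ ∀ a b c : ℤ,
    a ≠ 0 → b ≠ 0 → c ≠ 0 →
    IsCoprime a b → IsCoprime a c → IsCoprime b c →
    a + b = c →
    ((max (max |a| |b|) |c| : ℤ) : ℝ) ≤ K * (IntRadical (a * b * c) : ℝ) ^ (1 + ε)

/-- `d` is `n`-th power free. -/
def NthPowerFree (n : ℕ) (d : ℤ) : Prop :=
  d ≠ 0 ∧ ∀ p : ℕ, p.Prime → ¬ ((p : ℤ) ^ n ∣ d)

/-- A `K`-point of the twist `C_d : d·y^n = f(x)`. -/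
def HasTwistPoint (n : ℕ) (f : Polynomial ℤ) (d : ℤ) (K : Type) [CommRing K] : Prop :=
  ∃ x y : K, (d : K) * y ^ n = Polynomial.aeval x f

/-- The twist `C_d : d·y^n = f(x)` has points everywhere locally. -/
def EverywhereLocallySoluble (n : ℕ) (f : Polynomial ℤ) (d : ℤ) : Prop :=
  HasTwistPoint n f d ℝ ∧ ∀ (p : ℕ) (_ : Fact p.Prime), HasTwistPoint n f d ℚ_[p]

/-- The twist `C_d` violates the Hasse principle. -/
def ViolatesHasse (n : ℕ) (f : Polynomial ℤ) (d : ℤ) : Prop :=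
  EverywhereLocallySoluble n f d ∧ ¬ HasTwistPoint n f d ℚ

/-- `f` is weakly intersective: the primes modulo which `f` has a root have
relative natural density `1` in the primes. -/
def WeaklyIntersective (f : Polynomial ℤ) : Prop :=
  Filter.Tendsto (fun X : ℕ =>
      (Nat.card {ℓ : ℕ // ℓ ≤ X ∧ ℓ.Prime ∧ ∃ x : ZMod ℓ, Polynomial.aeval x f = 0} : ℝ) /
      (Nat.card {ℓ : ℕ // ℓ ≤ X ∧ ℓ.Prime} : ℝ))
    Filter.atTop (nhds 1)

section DedekindEuler

open NumberField IsDedekindDomain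

variable {K : Type*} [Field K] [NumberField K]

theorem absNorm_heightOneSpectrum_eq_pow (v : HeightOneSpectrum (𝓞 K)) :
    ∃ p k : ℕ, p.Prime ∧ 0 < k ∧ Ideal.absNorm v.asIdeal = p ^ k ∧
      v.asIdeal ∣ Ideal.span {(p : 𝓞 K)} := by
  have h0 : Ideal.absNorm v.asIdeal ≠ 0 := by
    rw [Ne, Ideal.absNorm_eq_zero_iff]; exact v.ne_bot
  have h1 : Ideal.absNorm v.asIdeal ≠ 1 := by
    rw [Ne, Ideal.absNorm_eq_one_iff]; exact v.isPrime.ne_top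
  have hmem := Ideal.absNorm_mem v.asIdeal
  have key : ∃ p : ℕ, p.Prime ∧ (p : 𝓞 K) ∈ v.asIdeal := by
    rw [← Nat.prod_primeFactorsList h0, Nat.cast_list_prod, ← Multiset.prod_coe,
      v.isPrime.multiset_prod_mem_iff_exists_mem] at hmem
    obtain ⟨a, ha, ha'⟩ := hmem
    obtain ⟨p, hp, rfl⟩ := List.mem_map.1 (Multiset.mem_coe.1 ha)
    exact ⟨p, Nat.prime_of_mem_primeFactorsList hp, ha'⟩
  obtain ⟨p, hp, hpv⟩ := key
  have hdvd : v.asIdeal ∣ Ideal.span {(p : 𝓞 K)} := by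
    rwa [Ideal.dvd_span_singleton]
  have h2 := map_dvd Ideal.absNorm hdvd
  rw [Ideal.absNorm_span_natCast, Nat.dvd_prime_pow hp] at h2
  obtain ⟨k, -, hk⟩ := h2
  refine ⟨p, k, hp, Nat.pos_of_ne_zero ?_, hk, hdvd⟩
  rintro rfl
  exact h1 (by simpa using hk)

/-- The residue characteristic of a maximal ideal. -/
noncomputable def resChar (v : HeightOneSpectrum (𝓞 K)) : ℕ :=
  (absNorm_heightOneSpectrum_eq_pow v).choose

theorem resChar_prime (v : HeightOneSpectrum (𝓞 K)) : (resChar v).Prime :=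
  (absNorm_heightOneSpectrum_eq_pow v).choose_spec.choose_spec.1

theorem absNorm_eq_resChar_pow (v : HeightOneSpectrum (𝓞 K)) :
    ∃ k : ℕ, 0 < k ∧ Ideal.absNorm v.asIdeal = resChar v ^ k :=
  ⟨_, (absNorm_heightOneSpectrum_eq_pow v).choose_spec.choose_spec.2.1,
    (absNorm_heightOneSpectrum_eq_pow v).choose_spec.choose_spec.2.2.1⟩

theorem dvd_resChar (v : HeightOneSpectrum (𝓞 K)) :
    v.asIdeal ∣ Ideal.span {(resChar v : 𝓞 K)} :=
  (absNorm_heightOneSpectrum_eq_pow v).choose_spec.choose_spec.2.2.2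

theorem resChar_le_absNorm (v : HeightOneSpectrum (𝓞 K)) :
    resChar v ≤ Ideal.absNorm v.asIdeal := by
  obtain ⟨k, hk, h⟩ := absNorm_eq_resChar_pow v
  rw [h]
  exact Nat.le_self_pow hk.ne' _

theorem card_resChar_le (T : Finset (HeightOneSpectrum (𝓞 K))) (p : ℕ)
    (hT : ∀ v ∈ T, resChar v = p) : T.card ≤ Module.finrank ℤ (𝓞 K) := by
  classical
  rcases T.eq_empty_or_nonempty with rfl | ⟨v₀, hv₀⟩
  · simp
  have hp : p.Prime := hT v₀ hv₀ ▸ resChar_prime v₀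
  have hdvd : ∏ v ∈ T, v.asIdeal ∣ Ideal.span {(p : 𝓞 K)} := by
    have h : ∏ I ∈ T.image HeightOneSpectrum.asIdeal, I ∣ Ideal.span {(p : 𝓞 K)} := by
      apply Finset.prod_primes_dvd
      · intro I hI
        obtain ⟨v, -, rfl⟩ := Finset.mem_image.1 hI
        exact v.prime
      · intro I hI
        obtain ⟨v, hv, rfl⟩ := Finset.mem_image.1 hI
        exact hT v hv ▸ dvd_resChar v
    rwa [Finset.prod_image (fun v _ w _ h => HeightOneSpectrum.ext h)] at h
  have h1 := map_dvd Ideal.absNorm hdvd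
  rw [map_prod, Ideal.absNorm_span_natCast] at h1
  have h2 : p ^ T.card ∣ ∏ v ∈ T, Ideal.absNorm v.asIdeal := by
    rw [← Finset.prod_const]
    apply Finset.prod_dvd_prod_of_dvd
    intro v hv
    obtain ⟨k, hk, h⟩ := absNorm_eq_resChar_pow v
    rw [h, hT v hv]
    exact dvd_pow_self _ hk.ne'
  exact (Nat.pow_dvd_pow_iff_le_right hp.one_lt).1 (h2.trans h1)

theorem sum_resChar_neg_two_le (T : Finset (HeightOneSpectrum (𝓞 K))) :
    ∑ v ∈ T, ((resChar v : ℝ) ^ 2)⁻¹ ≤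
      Module.finrank ℤ (𝓞 K) * ∑' n : ℕ, ((n : ℝ) ^ 2)⁻¹ := by
  classical
  have hs : Summable fun n : ℕ => ((n : ℝ) ^ 2)⁻¹ := by simp
  rw [← Finset.sum_fiberwise_of_maps_to (g := resChar) (t := T.image resChar)
    (fun v hv => Finset.mem_image_of_mem _ hv)]
  calc _ ≤ ∑ p ∈ T.image resChar, (Module.finrank ℤ (𝓞 K) : ℝ) * ((p : ℝ) ^ 2)⁻¹ := by
        refine Finset.sum_le_sum fun p _ => ?_
        rw [Finset.sum_congr rfl (g := fun _ => ((p : ℝ) ^ 2)⁻¹)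
          (fun v hv => by rw [(Finset.mem_filter.1 hv).2]), Finset.sum_const, nsmul_eq_mul]
        gcongr
        exact card_resChar_le _ p fun v hv => (Finset.mem_filter.1 hv).2
    _ ≤ _ := by
        rw [← Finset.mul_sum]
        gcongr
        exact hs.sum_le_tsum _ fun _ _ => by positivity

/-- Every finite product of distinct maximal ideals contributes to the zeta sum. -/
theorem prod_one_add_le (T : Finset (HeightOneSpectrum (𝓞 K))) (g : Ideal (𝓞 K) →*₀ ℝ) (B : ℝ)
    (hB : ∀ A : Finset (Ideal (𝓞 K)), (∀ I ∈ A, I ≠ ⊥) → ∑ I ∈ A, g I ≤ B) :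
    ∏ v ∈ T, (1 + g v.asIdeal) ≤ B := by
  classical
  rw [Finset.prod_one_add]
  have hinj : Set.InjOn (fun t : Finset (HeightOneSpectrum (𝓞 K)) => ∏ v ∈ t, v.asIdeal)
      (T.powerset : Set (Finset (HeightOneSpectrum (𝓞 K)))) := by
    intro s _ t _ hst
    ext v
    have aux : ∀ s : Finset (HeightOneSpectrum (𝓞 K)),
        v.asIdeal ∣ ∏ v ∈ s, v.asIdeal ↔ v ∈ s := by
      intro s
      rw [Prime.dvd_finsetProd_iff v.prime]
      constructor
      · rintro ⟨w, hw, h⟩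
        have : v = w := HeightOneSpectrum.ext
          (associated_iff_eq.1 ((Prime.dvd_prime_iff_associated v.prime w.prime).1 h))
        exact this ▸ hw
      · exact fun h => ⟨v, h, dvd_rfl⟩
    rw [← aux s, ← aux t]
    simp only at hst
    rw [hst]
  have := hB (T.powerset.image fun t => ∏ v ∈ t, v.asIdeal) (by
    intro I hI
    obtain ⟨t, -, rfl⟩ := Finset.mem_image.1 hI
    rw [← Ideal.zero_eq_bot, Finset.prod_ne_zero_iff]
    exact fun v _ => v.ne_bot)
  rw [Finset.sum_image hinj] at this
  simpa only [map_prod] using this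

theorem sum_le_prod_one_sub_inv (A : Finset (Ideal (𝓞 K))) (hA : ∀ I ∈ A, I ≠ ⊥)
    (g : Ideal (𝓞 K) →*₀ ℝ) (hg : ∀ I, 0 ≤ g I)
    (hg1 : ∀ v : HeightOneSpectrum (𝓞 K), g v.asIdeal < 1) :
    ∃ T : Finset (HeightOneSpectrum (𝓞 K)),
      ∑ I ∈ A, g I ≤ ∏ v ∈ T, (1 - g v.asIdeal)⁻¹ := by
  classical
  let T : Finset (HeightOneSpectrum (𝓞 K)) := A.attach.biUnion fun I =>
    (Ideal.hasFiniteMulSupport (hA I.1 I.2) : Set.Finite _).toFinset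
  let e : HeightOneSpectrum (𝓞 K) → Ideal (𝓞 K) → ℕ := fun v I =>
    (Associates.mk v.asIdeal).count (Associates.mk I).factors
  have hfac : ∀ I ∈ A, I = ∏ v : T, v.1.asIdeal ^ e v.1 I := by
    intro I hI
    conv_lhs => rw [← Ideal.finprod_heightOneSpectrum_factorization (hA I hI)]
    rw [finprod_eq_prod_of_mulSupport_subset (s := T)]
    · rw [← Finset.prod_coe_sort]
      rfl
    · intro v hv
      simp only [T, Finset.coe_biUnion, Set.mem_iUnion]
      exact ⟨⟨I, hI⟩, Finset.mem_coe.2 (Finset.mem_attach _ _), (Set.Finite.mem_toFinset _).2 hv⟩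
  let E : ℕ := (A.biUnion fun I => T.image fun v => e v I).sup id + 1
  have hE : ∀ I ∈ A, ∀ v ∈ T, e v I < E := by
    intro I hI v hv
    refine Nat.lt_succ_of_le (Finset.le_sup (f := id) (b := e v I) ?_)
    exact Finset.mem_biUnion.2 ⟨I, hI, Finset.mem_image_of_mem _ hv⟩
  refine ⟨T, ?_⟩
  calc ∑ I ∈ A, g I
      ≤ ∑ φ ∈ Fintype.piFinset (fun _ : T => Finset.range E), ∏ v : T, g v.1.asIdeal ^ φ v := by
        rw [Finset.sum_congr rfl (g := fun I =>
          (fun φ : T → ℕ => ∏ v : T, g v.1.asIdeal ^ φ v) (fun v : T => e v.1 I))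
          (fun I hI => by
            conv_lhs => rw [hfac I hI]
            simp only [map_prod, map_pow])]
        rw [← Finset.sum_image (f := fun φ : T → ℕ => ∏ v : T, g v.1.asIdeal ^ φ v)
          (g := fun I => fun v : T => e v.1 I)]
        · refine Finset.sum_le_sum_of_subset_of_nonneg ?_ fun φ _ _ =>
            Finset.prod_nonneg fun v _ => pow_nonneg (hg _) _
          intro φ hφ
          obtain ⟨I, hI, rfl⟩ := Finset.mem_image.1 hφ
          exact Fintype.mem_piFinset.2 fun v => Finset.mem_range.2 (hE I hI v v.2)
        · intro I hI J hJ hIJ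
          rw [hfac I hI, hfac J hJ]
          exact Finset.prod_congr rfl fun v _ => by
            have := congrFun hIJ v
            simp only at this
            rw [this]
    _ = ∏ v : T, ∑ j ∈ Finset.range E, g v.1.asIdeal ^ j :=
        (Finset.prod_univ_sum (fun _ : T => Finset.range E) fun v j => g v.1.asIdeal ^ j).symm
    _ ≤ ∏ v : T, (1 - g v.1.asIdeal)⁻¹ := by
        refine Finset.prod_le_prod (fun v _ => Finset.sum_nonneg fun _ _ => pow_nonneg (hg _) _)
          fun v _ => ?_
        rw [← tsum_geometric_of_lt_one (hg _) (hg1 _)]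
        exact (summable_geometric_of_lt_one (hg _) (hg1 _)).sum_le_tsum _
          fun _ _ => pow_nonneg (hg _) _
    _ = ∏ v ∈ T, (1 - g v.asIdeal)⁻¹ := Finset.prod_coe_sort T fun v => (1 - g v.asIdeal)⁻¹

end DedekindEuler

section DedekindLog

open NumberField IsDedekindDomain Filter Topology

variable (K : Type*) [Field K] [NumberField K]

/-- The number of ideals of norm `n`. -/
noncomputable def idealCount (n : ℕ) : ℕ := Nat.card {I : Ideal (𝓞 K) // Ideal.absNorm I = n}

/-- The coefficients of the Dedekind zeta function at a real argument. -/
noncomputable def zetaTerm (s : ℝ) (n : ℕ) : ℝ :=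
  if n = 0 then 0 else idealCount K n * (n : ℝ) ^ (-s)

theorem zetaTerm_nonneg (s : ℝ) (n : ℕ) : 0 ≤ zetaTerm K s n := by
  unfold zetaTerm; split_ifs <;> positivity

theorem dedekindZeta_ofReal (s : ℝ) :
    dedekindZeta K s = ((∑' n, zetaTerm K s n : ℝ) : ℂ) := by
  rw [dedekindZeta, LSeries, Complex.ofReal_tsum]
  congr 1
  ext n
  rw [LSeries.term_def, zetaTerm]
  split_ifs with h
  · simp
  · push_cast
    rw [div_eq_mul_inv, Complex.ofReal_cpow (by positivity)]
    push_cast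
    rw [Complex.cpow_neg]
    rfl

/-- The map `I ↦ N(I)^{-s}`. -/
noncomputable def normPow (s : ℝ) (hs : 0 < s) : Ideal (𝓞 K) →*₀ ℝ where
  toFun I := (Ideal.absNorm I : ℝ) ^ (-s)
  map_zero' := by
    simp [Real.zero_rpow (neg_ne_zero.2 hs.ne')]
  map_one' := by simp
  map_mul' I J := by
    rw [map_mul, Nat.cast_mul, Real.mul_rpow (by positivity) (by positivity)]

theorem sum_normPow_eq_zetaTerm (s : ℝ) (hs : 0 < s) (n : ℕ) (hn : n ≠ 0)
    (A : Finset (Ideal (𝓞 K))) (hA : ∀ I, I ∈ A ↔ Ideal.absNorm I = n) :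
    ∑ I ∈ A, normPow K s hs I = zetaTerm K s n := by
  rw [zetaTerm, if_neg hn, Finset.sum_congr rfl (g := fun _ => (n : ℝ) ^ (-s))
    (fun I hI => by
      change (Ideal.absNorm I : ℝ) ^ (-s) = _
      rw [(hA I).1 hI]), Finset.sum_const, nsmul_eq_mul, idealCount]
  congr 2
  rw [← Nat.card_eq_finsetCard A]
  exact Nat.card_congr (Equiv.subtypeEquivRight hA)

theorem sum_normPow_le (s : ℝ) (hs : 0 < s) (hsum : Summable (zetaTerm K s))
    (A : Finset (Ideal (𝓞 K))) (hA : ∀ I ∈ A, I ≠ ⊥) :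
    ∑ I ∈ A, normPow K s hs I ≤ ∑' n, zetaTerm K s n := by
  classical
  rw [← Finset.sum_fiberwise_of_maps_to (g := fun I => Ideal.absNorm I)
    (t := A.image fun I => Ideal.absNorm I) (fun v hv => Finset.mem_image_of_mem _ hv)]
  calc _ ≤ ∑ n ∈ A.image fun I => Ideal.absNorm I, zetaTerm K s n := by
        refine Finset.sum_le_sum fun n hn => ?_
        obtain ⟨I, hI, rfl⟩ := Finset.mem_image.1 hn
        have h0 : Ideal.absNorm I ≠ 0 := by
          rw [Ne, Ideal.absNorm_eq_zero_iff]; exact hA I hI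
        rw [← sum_normPow_eq_zetaTerm K s hs _ h0
          (Ideal.finite_setOfPred_absNorm_eq (S := 𝓞 K) (Ideal.absNorm I)).toFinset (by simp)]
        refine Finset.sum_le_sum_of_subset_of_nonneg (fun J hJ => ?_) fun J _ _ => ?_
        · simpa using (Finset.mem_filter.1 hJ).2
        · exact Real.rpow_nonneg (by positivity) _
    _ ≤ _ := hsum.sum_le_tsum _ fun n _ => zetaTerm_nonneg K s n

theorem exists_sum_normPow_eq (s : ℝ) (hs : 0 < s) (X : ℕ) :
    ∃ A : Finset (Ideal (𝓞 K)), (∀ I ∈ A, I ≠ ⊥) ∧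
      ∑ n ∈ Finset.range X, zetaTerm K s n = ∑ I ∈ A, normPow K s hs I := by
  classical
  have hf := Ideal.finite_setOfPred_absNorm_le (S := 𝓞 K) X
  refine ⟨hf.toFinset.filter fun I => Ideal.absNorm I ∈ (Finset.range X).filter (· ≠ 0), ?_, ?_⟩
  · intro I hI
    have := (Finset.mem_filter.1 (Finset.mem_filter.1 hI).2).2
    rwa [Ne, Ideal.absNorm_eq_zero_iff] at this
  · rw [← Finset.sum_fiberwise_of_maps_to (g := fun I => Ideal.absNorm I)
      (t := (Finset.range X).filter (· ≠ 0)) (fun I hI => (Finset.mem_filter.1 hI).2),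
      Finset.sum_filter]
    refine Finset.sum_congr rfl fun n hn => ?_
    split_ifs with h
    · rw [sum_normPow_eq_zetaTerm K s hs n h]
      intro I
      simp only [Finset.mem_filter, Set.Finite.mem_toFinset, Set.mem_ofPred_eq]
      constructor
      · exact fun h => h.2
      · rintro rfl
        exact ⟨⟨(Finset.mem_range.1 hn).le, hn, h⟩, rfl⟩
    · rw [not_not] at h
      simp [zetaTerm, h]

/-- The contribution of ideals of prime norm. -/
noncomputable def primeTerm (s : ℝ) (p : Nat.Primes) : ℝ :=
  idealCount K p * ((p : ℕ) : ℝ) ^ (-s)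

theorem primeTerm_nonneg (s : ℝ) (p : Nat.Primes) : 0 ≤ primeTerm K s p := by
  unfold primeTerm; positivity

variable {K} in
theorem normPow_le_half (s : ℝ) (hs : 1 < s) (v : HeightOneSpectrum (𝓞 K)) :
    normPow K s (by linarith) v.asIdeal ≤ ((resChar v : ℝ))⁻¹ ∧
      normPow K s (by linarith) v.asIdeal ≤ 1 / 2 := by
  have h2 : (2 : ℝ) ≤ resChar v := by exact_mod_cast (resChar_prime v).two_le
  have h : normPow K s (by linarith) v.asIdeal ≤ ((resChar v : ℝ))⁻¹ := by
    change (Ideal.absNorm v.asIdeal : ℝ) ^ (-s) ≤ _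
    have h1 : (resChar v : ℝ) ≤ Ideal.absNorm v.asIdeal := by exact_mod_cast resChar_le_absNorm v
    calc (Ideal.absNorm v.asIdeal : ℝ) ^ (-s) ≤ (Ideal.absNorm v.asIdeal : ℝ) ^ (-1 : ℝ) :=
          Real.rpow_le_rpow_of_exponent_le (by linarith) (by linarith)
      _ = (Ideal.absNorm v.asIdeal : ℝ)⁻¹ := Real.rpow_neg_one _
      _ ≤ _ := by gcongr
  refine ⟨h, h.trans ?_⟩
  rw [one_div]
  gcongr

variable {K} in
theorem normPow_le_of_not_prime (s : ℝ) (hs : 1 < s) (v : HeightOneSpectrum (𝓞 K))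
    (hv : ¬ (Ideal.absNorm v.asIdeal).Prime) :
    normPow K s (by linarith) v.asIdeal ≤ ((resChar v : ℝ) ^ 2)⁻¹ := by
  have hp := resChar_prime v
  obtain ⟨k, hk, hvk⟩ := absNorm_eq_resChar_pow v
  have hk2 : 2 ≤ k := by
    rcases Nat.lt_or_ge k 2 with h | h
    · have : k = 1 := by omega
      rw [hvk, this, pow_one] at hv
      exact absurd hp hv
    · exact h
  change (Ideal.absNorm v.asIdeal : ℝ) ^ (-s) ≤ _
  have h2 : (1 : ℝ) ≤ resChar v := by exact_mod_cast hp.one_lt.le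
  have h1 : (resChar v : ℝ) ^ 2 ≤ Ideal.absNorm v.asIdeal := by
    rw [hvk]; push_cast; exact pow_le_pow_right₀ h2 hk2
  have h3 : (1 : ℝ) ≤ Ideal.absNorm v.asIdeal := le_trans (one_le_pow₀ h2) h1
  calc (Ideal.absNorm v.asIdeal : ℝ) ^ (-s) ≤ (Ideal.absNorm v.asIdeal : ℝ) ^ (-1 : ℝ) :=
        Real.rpow_le_rpow_of_exponent_le h3 (by linarith)
    _ = (Ideal.absNorm v.asIdeal : ℝ)⁻¹ := Real.rpow_neg_one _
    _ ≤ _ := by gcongr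

theorem normPow_sq_le (s : ℝ) (hs : 1 < s) (v : HeightOneSpectrum (𝓞 K)) :
    normPow K s (by linarith) v.asIdeal ^ 2 ≤ ((resChar v : ℝ) ^ 2)⁻¹ := by
  rw [← inv_pow]
  exact pow_le_pow_left₀ (Real.rpow_nonneg (by positivity) _) (normPow_le_half s hs v).1 _

theorem exp_sub_sq_le {x : ℝ} (hx : 0 ≤ x) : Real.exp (x - x ^ 2) ≤ 1 + x := by
  have h1 : x - x ^ 2 ≤ x / (1 + x) := by
    rw [le_div_iff₀ (by linarith)]; nlinarith [pow_nonneg hx 3]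
  have h2 := Real.add_one_le_exp (-(x / (1 + x)))
  have h3 : -(x / (1 + x)) + 1 = (1 + x)⁻¹ := by field_simp; ring
  rw [h3, Real.exp_neg] at h2
  exact (Real.exp_le_exp.2 h1).trans ((inv_le_inv₀ (by linarith) (Real.exp_pos _)).1 h2)

theorem one_sub_inv_le_exp {x : ℝ} (hx2 : x ≤ 1 / 2) :
    (1 - x)⁻¹ ≤ Real.exp (x + 2 * x ^ 2) := by
  have h1 : x / (1 - x) ≤ x + 2 * x ^ 2 := by
    rw [div_le_iff₀ (by linarith)]; nlinarith [mul_self_nonneg x]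
  have h2 := Real.add_one_le_exp (x / (1 - x))
  have h4 : 1 - x ≠ 0 := by linarith
  have h3 : x / (1 - x) + 1 = (1 - x)⁻¹ := by field_simp; ring
  rw [h3] at h2
  exact h2.trans (Real.exp_le_exp.2 h1)

/-- The error term in comparing `log ζ_K(s)` with the sum over ideals of prime norm. -/
noncomputable def zetaError : ℝ := Module.finrank ℤ (𝓞 K) * ∑' n : ℕ, ((n : ℝ) ^ 2)⁻¹

theorem zeta_le_exp (s : ℝ) (hs : 1 < s) (hprime : Summable (primeTerm K s)) :
    ∑' n, zetaTerm K s n ≤ Real.exp (∑' p, primeTerm K s p + 3 * zetaError K) := by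
  classical
  refine Real.tsum_le_of_sum_range_le (zetaTerm_nonneg K s) fun X => ?_
  have hs0 : 0 < s := by linarith
  obtain ⟨A, hA, hAX⟩ := exists_sum_normPow_eq K s hs0 X
  have hg0 : ∀ I, 0 ≤ normPow K s hs0 I := fun I => Real.rpow_nonneg (by positivity) _
  obtain ⟨T, hT⟩ := sum_le_prod_one_sub_inv A hA (normPow K s hs0) hg0
    (fun v => (normPow_le_half s hs v).2.trans_lt (by norm_num))
  rw [hAX]
  refine hT.trans ?_
  calc _ ≤ ∏ v ∈ T, Real.exp (normPow K s hs0 v.asIdeal + 2 * normPow K s hs0 v.asIdeal ^ 2) :=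
        Finset.prod_le_prod (fun v _ => inv_nonneg.2
          (by linarith [(normPow_le_half s hs v).2]))
          fun v _ => one_sub_inv_le_exp (normPow_le_half s hs v).2
    _ = Real.exp (∑ v ∈ T, (normPow K s hs0 v.asIdeal + 2 * normPow K s hs0 v.asIdeal ^ 2)) :=
        (Real.exp_sum _ _).symm
    _ ≤ _ := Real.exp_le_exp.2 ?_
  rw [Finset.sum_add_distrib, ← Finset.mul_sum]
  have h1 : ∑ v ∈ T, normPow K s hs0 v.asIdeal ^ 2 ≤ zetaError K :=
    (Finset.sum_le_sum fun v _ => normPow_sq_le K s hs v).trans (sum_resChar_neg_two_le T)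
  have h2 : ∑ v ∈ T with ¬ (Ideal.absNorm v.asIdeal).Prime, normPow K s hs0 v.asIdeal
      ≤ zetaError K :=
    (Finset.sum_le_sum fun v hv =>
      normPow_le_of_not_prime s hs v (Finset.mem_filter.1 hv).2).trans (sum_resChar_neg_two_le _)
  have h3 : ∑ v ∈ T with (Ideal.absNorm v.asIdeal).Prime, normPow K s hs0 v.asIdeal
      ≤ ∑' p, primeTerm K s p := by
    rw [← Finset.sum_subtype_eq_sum_filter]
    let q : {v : HeightOneSpectrum (𝓞 K) // (Ideal.absNorm v.asIdeal).Prime} → Nat.Primes :=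
      fun v => ⟨Ideal.absNorm v.1.asIdeal, v.2⟩
    rw [← Finset.sum_fiberwise_of_maps_to (g := q) (t := Finset.image q _)
      (fun v hv => Finset.mem_image_of_mem _ hv)]
    refine le_trans (Finset.sum_le_sum (g := primeTerm K s) fun p _ => ?_)
      (hprime.sum_le_tsum _ fun p _ => primeTerm_nonneg K s p)
    have := sum_normPow_eq_zetaTerm K s hs0 p p.2.ne_zero
      (Ideal.finite_setOfPred_absNorm_eq (S := 𝓞 K) (p : ℕ)).toFinset (by simp)
    rw [zetaTerm, if_neg p.2.ne_zero] at this
    rw [primeTerm, ← this, ← Finset.sum_image (f := fun I => normPow K s hs0 I)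
      (g := fun v : {v : HeightOneSpectrum (𝓞 K) //
          (Ideal.absNorm v.asIdeal).Prime} => v.1.asIdeal)]
    · refine Finset.sum_le_sum_of_subset_of_nonneg (fun J hJ => ?_) fun J _ _ => hg0 J
      obtain ⟨v, hv, rfl⟩ := Finset.mem_image.1 hJ
      have := (Finset.mem_filter.1 hv).2
      rw [Set.Finite.mem_toFinset]
      exact congrArg Subtype.val this
    · intro v _ w _ h
      exact Subtype.ext (HeightOneSpectrum.ext h)
  have h4 := Finset.sum_filter_add_sum_filter_not T
    (fun v => (Ideal.absNorm v.asIdeal).Prime) fun v => normPow K s hs0 v.asIdeal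
  linarith

theorem exp_sum_primeTerm_le (s : ℝ) (hs : 1 < s) (hsum : Summable (zetaTerm K s))
    (U : Finset Nat.Primes) :
    Real.exp (∑ p ∈ U, primeTerm K s p - zetaError K) ≤ ∑' n, zetaTerm K s n := by
  classical
  have hs0 : 0 < s := by linarith
  have hg0 : ∀ I, 0 ≤ normPow K s hs0 I := fun I => Real.rpow_nonneg (by positivity) _
  let A : Nat.Primes → Finset (Ideal (𝓞 K)) := fun p =>
    (Ideal.finite_setOfPred_absNorm_eq (S := 𝓞 K) (p : ℕ)).toFinset
  have hA : ∀ p I, I ∈ A p ↔ Ideal.absNorm I = p := fun p I => by simp [A]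
  have hAP : ∀ I ∈ U.biUnion A, ∃ v : HeightOneSpectrum (𝓞 K), v.asIdeal = I := by
    intro I hI
    obtain ⟨p, -, hp⟩ := Finset.mem_biUnion.1 hI
    rw [hA] at hp
    refine ⟨⟨I, Ideal.isPrime_of_irreducible_absNorm (by rw [hp]; exact p.2), ?_⟩, rfl⟩
    rintro rfl
    rw [Ideal.absNorm_bot] at hp
    exact p.2.ne_zero hp.symm
  have hfin : (HeightOneSpectrum.asIdeal ⁻¹' (U.biUnion A : Set (Ideal (𝓞 K)))).Finite :=
    Set.Finite.preimage (fun v _ w _ h => HeightOneSpectrum.ext h) (Finset.finite_toSet _)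
  have key : ∑ v ∈ hfin.toFinset, normPow K s hs0 v.asIdeal = ∑ p ∈ U, primeTerm K s p := by
    rw [← Finset.sum_image (f := fun I => normPow K s hs0 I)
      (fun v _ w _ h => HeightOneSpectrum.ext h)]
    have : hfin.toFinset.image HeightOneSpectrum.asIdeal = U.biUnion A := by
      ext I
      simp only [Finset.mem_image, Set.Finite.mem_toFinset, Set.mem_preimage, Finset.mem_coe]
      constructor
      · rintro ⟨v, hv, rfl⟩; exact hv
      · intro h
        obtain ⟨v, rfl⟩ := hAP I h
        exact ⟨v, h, rfl⟩
    rw [this, Finset.sum_biUnion]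
    · refine Finset.sum_congr rfl fun p _ => ?_
      rw [sum_normPow_eq_zetaTerm K s hs0 p p.2.ne_zero _ (hA p), zetaTerm,
        if_neg p.2.ne_zero, primeTerm]
    · intro p _ q _ hpq
      refine Finset.disjoint_left.2 fun I hI hI' => hpq ?_
      rw [hA] at hI hI'
      exact Subtype.ext (hI.symm.trans hI')
  refine le_trans ?_ (prod_one_add_le hfin.toFinset (normPow K s hs0) _
    (fun A hA => sum_normPow_le K s hs0 hsum A hA))
  calc _ ≤ Real.exp (∑ v ∈ hfin.toFinset,
        (normPow K s hs0 v.asIdeal - normPow K s hs0 v.asIdeal ^ 2)) := by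
        rw [Real.exp_le_exp, Finset.sum_sub_distrib, key]
        have : ∑ v ∈ hfin.toFinset, normPow K s hs0 v.asIdeal ^ 2 ≤ zetaError K :=
          (Finset.sum_le_sum fun v _ => normPow_sq_le K s hs v).trans (sum_resChar_neg_two_le _)
        linarith
    _ = ∏ v ∈ hfin.toFinset,
        Real.exp (normPow K s hs0 v.asIdeal - normPow K s hs0 v.asIdeal ^ 2) := Real.exp_sum _ _
    _ ≤ _ := Finset.prod_le_prod (fun _ _ => (Real.exp_pos _).le) fun v _ => exp_sub_sq_le (hg0 _)

theorem tendsto_log_one_div : Tendsto (fun s : ℝ => Real.log (1 / (s - 1))) (𝓝[>] 1) atTop := by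
  refine Real.tendsto_log_atTop.comp ?_
  simp_rw [one_div]
  refine tendsto_inv_nhdsGT_zero.comp ?_
  rw [tendsto_nhdsWithin_iff]
  constructor
  · refine Tendsto.mono_left ?_ nhdsWithin_le_nhds
    exact Continuous.tendsto' (by fun_prop) _ _ (by simp)
  · filter_upwards [self_mem_nhdsWithin] with s hs
    simpa using hs

/-- The sum over ideals of prime norm is asymptotic to `log (1 / (s - 1))`. -/
theorem tendsto_primeTerm_div_log :
    (∀ᶠ s in 𝓝[>] (1 : ℝ), Summable (primeTerm K s)) ∧
    Tendsto (fun s : ℝ => (∑' p, primeTerm K s p) / Real.log (1 / (s - 1))) (𝓝[>] 1) (𝓝 1) := by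
  have h1 := tendsto_sub_one_mul_dedekindZeta_nhdsGT K
  have h2 : Tendsto (fun s : ℝ => (s - 1) * ∑' n, zetaTerm K s n) (𝓝[>] 1)
      (𝓝 (dedekindZeta_residue K)) := by
    have := (Complex.continuous_re.tendsto _).comp h1
    refine (this.congr fun s => ?_)
    simp only [Function.comp_apply, dedekindZeta_ofReal]
    norm_cast
  have hκ := dedekindZeta_residue_pos K
  have hpos : ∀ᶠ s in 𝓝[>] (1 : ℝ), 0 < ∑' n, zetaTerm K s n := by
    filter_upwards [h2.eventually_const_lt hκ, self_mem_nhdsWithin] with s hs hs1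
    exact (pos_iff_pos_of_mul_pos hs).1 (sub_pos.2 hs1)
  have hsum : ∀ᶠ s in 𝓝[>] (1 : ℝ), Summable (zetaTerm K s) := by
    filter_upwards [hpos] with s hs
    by_contra h
    rw [tsum_eq_zero_of_not_summable h] at hs
    exact lt_irrefl _ hs
  have hlow : ∀ᶠ s in 𝓝[>] (1 : ℝ), ∀ U : Finset Nat.Primes,
      ∑ p ∈ U, primeTerm K s p ≤ Real.log (∑' n, zetaTerm K s n) + zetaError K := by
    filter_upwards [hpos, hsum, self_mem_nhdsWithin] with s hs hs' hs1 U
    have := (Real.le_log_iff_exp_le hs).2 (exp_sum_primeTerm_le K s hs1 hs' U)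
    linarith
  have hprime : ∀ᶠ s in 𝓝[>] (1 : ℝ), Summable (primeTerm K s) := by
    filter_upwards [hlow] with s hs
    exact summable_of_sum_le (primeTerm_nonneg K s) hs
  refine ⟨hprime, ?_⟩
  have hlog : Tendsto (fun s : ℝ => Real.log (∑' n, zetaTerm K s n) / Real.log (1 / (s - 1)))
      (𝓝[>] 1) (𝓝 1) := by
    have h3 := (h2.log hκ.ne').div_atTop tendsto_log_one_div
    have h4 := h3.add_const 1
    rw [zero_add] at h4
    refine h4.congr' ?_
    filter_upwards [hpos, self_mem_nhdsWithin, tendsto_log_one_div.eventually_gt_atTop 0]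
      with s hs hs1 hl
    rw [Real.log_mul (sub_pos.2 hs1).ne' hs.ne', div_add_one hl.ne']
    congr 1
    rw [one_div, Real.log_inv]
    ring
  have hc : ∀ c : ℝ, Tendsto (fun s : ℝ => Real.log (∑' n, zetaTerm K s n) /
      Real.log (1 / (s - 1)) + c / Real.log (1 / (s - 1))) (𝓝[>] 1) (𝓝 1) := by
    intro c
    simpa using hlog.add (tendsto_log_one_div.const_div_atTop c)
  refine tendsto_of_tendsto_of_tendsto_of_le_of_le' (hc (-(3 * zetaError K)))
    (hc (zetaError K)) ?_ ?_
  · filter_upwards [hpos, hprime, self_mem_nhdsWithin,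
      tendsto_log_one_div.eventually_gt_atTop 0] with s hs hp hs1 hl
    rw [← add_div]
    gcongr
    have := (Real.log_le_iff_le_exp hs).2 (zeta_le_exp K s hs1 hp)
    linarith
  · filter_upwards [hprime, hlow, tendsto_log_one_div.eventually_gt_atTop 0] with s hp hs hl
    rw [← add_div]
    gcongr
    exact hp.tsum_le_of_sum_le hs

end DedekindLog

section PrimeMean

open NumberField Filter Topology

/-- The function `φ` on the primes is bounded, with average `c` in the sense of Dirichlet
density. -/
def PrimeMean (φ : Nat.Primes → ℝ) (c : ℝ) : Prop :=
  (∃ B, ∀ p, |φ p| ≤ B) ∧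
  Tendsto (fun s : ℝ => (∑' p : Nat.Primes, φ p * ((p : ℕ) : ℝ) ^ (-s)) / Real.log (1 / (s - 1)))
    (𝓝[>] 1) (𝓝 c)

theorem summable_primes_mul {φ : Nat.Primes → ℝ} (hφ : ∃ B, ∀ p, |φ p| ≤ B) {s : ℝ} (hs : 1 < s) :
    Summable fun p : Nat.Primes => φ p * ((p : ℕ) : ℝ) ^ (-s) := by
  obtain ⟨B, hB⟩ := hφ
  have h := (Nat.Primes.summable_rpow (r := -s)).2 (by linarith)
  refine Summable.of_norm_bounded (h.mul_left B) fun p => ?_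
  rw [norm_mul, Real.norm_eq_abs, Real.norm_of_nonneg (Real.rpow_nonneg (by positivity) _)]
  exact mul_le_mul_of_nonneg_right (hB p) (Real.rpow_nonneg (by positivity) _)

theorem PrimeMean.add {φ ψ : Nat.Primes → ℝ} {c d : ℝ} (h : PrimeMean φ c) (h' : PrimeMean ψ d) :
    PrimeMean (fun p => φ p + ψ p) (c + d) := by
  refine ⟨?_, ?_⟩
  · obtain ⟨B, hB⟩ := h.1
    obtain ⟨B', hB'⟩ := h'.1
    exact ⟨B + B', fun p => (abs_add_le _ _).trans (add_le_add (hB p) (hB' p))⟩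
  · refine (h.2.add h'.2).congr' ?_
    filter_upwards [self_mem_nhdsWithin] with s hs
    rw [← add_div, ← (summable_primes_mul h.1 hs).tsum_add (summable_primes_mul h'.1 hs)]
    simp_rw [add_mul]

theorem PrimeMean.const_mul {φ : Nat.Primes → ℝ} {c : ℝ} (a : ℝ) (h : PrimeMean φ c) :
    PrimeMean (fun p => a * φ p) (a * c) := by
  refine ⟨?_, ?_⟩
  · obtain ⟨B, hB⟩ := h.1
    exact ⟨|a| * B, fun p => by rw [abs_mul]; gcongr; exact hB p⟩
  · refine (h.2.const_mul a).congr fun s => ?_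
    rw [← mul_div_assoc, ← tsum_mul_left]
    simp_rw [mul_assoc]

theorem PrimeMean.sum {ι : Type*} (S : Finset ι) {φ : ι → Nat.Primes → ℝ} {c : ι → ℝ}
    (h : ∀ i ∈ S, PrimeMean (φ i) (c i)) :
    PrimeMean (fun p => ∑ i ∈ S, φ i p) (∑ i ∈ S, c i) := by
  classical
  induction S using Finset.induction_on with
  | empty => exact ⟨⟨0, by simp⟩, by simp⟩
  | insert a S ha ih =>
    simp_rw [Finset.sum_insert ha]
    exact (h a (Finset.mem_insert_self _ _)).add
      (ih fun i hi => h i (Finset.mem_insert_of_mem hi))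

theorem PrimeMean.le {φ ψ : Nat.Primes → ℝ} {c d : ℝ} (h : PrimeMean φ c) (h' : PrimeMean ψ d)
    (hle : ∀ p, φ p ≤ ψ p) : c ≤ d := by
  refine le_of_tendsto_of_tendsto h.2 h'.2 ?_
  filter_upwards [self_mem_nhdsWithin, tendsto_log_one_div.eventually_gt_atTop 0] with s hs hl
  gcongr 1
  exact (summable_primes_mul h.1 hs).tsum_le_tsum (fun p => mul_le_mul_of_nonneg_right (hle p)
    (Real.rpow_nonneg (by positivity) _)) (summable_primes_mul h'.1 hs)

theorem primeMean_of_finite_support {φ : Nat.Primes → ℝ} (S : Finset Nat.Primes)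
    (h : ∀ p ∉ S, φ p = 0) : PrimeMean φ 0 := by
  refine ⟨⟨∑ p ∈ S, |φ p|, fun p => ?_⟩, ?_⟩
  · by_cases hp : p ∈ S
    · exact Finset.single_le_sum (f := fun p => |φ p|) (fun _ _ => abs_nonneg _) hp
    · rw [h p hp, abs_zero]
      exact Finset.sum_nonneg fun _ _ => abs_nonneg _
  · have h1 : ∀ s : ℝ, ∑' p : Nat.Primes, φ p * ((p : ℕ) : ℝ) ^ (-s) =
        ∑ p ∈ S, φ p * ((p : ℕ) : ℝ) ^ (-s) := fun s =>
      tsum_eq_sum fun p hp => by rw [h p hp, zero_mul]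
    simp_rw [h1]
    refine Tendsto.div_atTop (a := ∑ p ∈ S, φ p * ((p : ℕ) : ℝ) ^ (-1 : ℝ)) ?_ tendsto_log_one_div
    refine Tendsto.mono_left ?_ nhdsWithin_le_nhds
    refine tendsto_finsetSum _ fun p _ => Tendsto.const_mul _ ?_
    have hp : ((p : ℕ) : ℝ) ≠ 0 := by exact_mod_cast p.2.ne_zero
    exact (Real.continuousAt_const_rpow hp).tendsto.comp (continuous_neg.tendsto _)

theorem PrimeMean.congr_of_finite {φ ψ : Nat.Primes → ℝ} {c : ℝ} (h : PrimeMean φ c)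
    (S : Finset Nat.Primes) (hS : ∀ p ∉ S, φ p = ψ p) : PrimeMean ψ c := by
  have := h.add (primeMean_of_finite_support (φ := fun p => ψ p - φ p) S
    fun p hp => by rw [hS p hp, sub_self])
  have e : (fun p => φ p + (ψ p - φ p)) = ψ := by funext p; ring
  rw [add_zero] at this
  exact e ▸ this

theorem primeMean_of_idealCount (K : Type*) [Field K] [NumberField K] {φ : Nat.Primes → ℝ}
    (hφ : ∃ B, ∀ p, |φ p| ≤ B) (S : Finset Nat.Primes) (hS : ∀ p ∉ S, φ p = idealCount K p) :
    PrimeMean φ 1 := by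
  have hb : ∃ B, ∀ p : Nat.Primes, |(idealCount K p : ℝ)| ≤ B := by
    obtain ⟨B, hB⟩ := hφ
    refine ⟨B + ∑ p ∈ S, |(idealCount K p : ℝ)|, fun p => ?_⟩
    by_cases hp : p ∈ S
    · have h1 := Finset.single_le_sum (f := fun p : Nat.Primes => |(idealCount K p : ℝ)|)
        (fun _ _ => abs_nonneg _) hp
      have h2 := (abs_nonneg _).trans (hB p)
      linarith
    · rw [← hS p hp]
      have : 0 ≤ ∑ p ∈ S, |(idealCount K p : ℝ)| := Finset.sum_nonneg fun _ _ => abs_nonneg _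
      linarith [hB p]
  exact PrimeMean.congr_of_finite (φ := fun p => (idealCount K p : ℝ))
    ⟨hb, (tendsto_primeTerm_div_log K).2⟩ S fun p hp => (hS p hp).symm

theorem sum_mul_le_of_partial_sums_le {c w : ℕ → ℝ} {D : ℝ} (hw : Antitone w)
    (hw0 : ∀ n, 0 ≤ w n) (hD : ∀ n, ∑ i ∈ Finset.range n, c i ≤ D) (N : ℕ) :
    ∑ i ∈ Finset.range N, c i * w i ≤ D * w 0 := by
  have key : ∀ N, ∑ i ∈ Finset.range (N + 1), c i * w i +
      (D - ∑ i ∈ Finset.range (N + 1), c i) * w N ≤ D * w 0 := by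
    intro N
    induction N with
    | zero => simp; linarith
    | succ N ih =>
      rw [Finset.sum_range_succ, Finset.sum_range_succ (fun i => c i)]
      have := mul_le_mul_of_nonneg_left (hw (Nat.le_succ N)) (sub_nonneg.2 (hD (N + 1)))
      simp only [Nat.succ_eq_add_one] at this
      linarith
  cases N with
  | zero => simpa using mul_nonneg (by simpa using hD 0) (hw0 0)
  | succ N =>
    have := mul_nonneg (sub_nonneg.2 (hD (N + 1))) (hw0 N)
    linarith [key N]

theorem one_le_idealCount_rat (p : ℕ) : 1 ≤ idealCount ℚ p := by
  have hf : Finite {I : Ideal (𝓞 ℚ) // Ideal.absNorm I = p} :=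
    (Ideal.finite_setOfPred_absNorm_eq (S := 𝓞 ℚ) p).to_subtype
  have : Nonempty {I : Ideal (𝓞 ℚ) // Ideal.absNorm I = p} := by
    refine ⟨Ideal.span {(p : 𝓞 ℚ)}, ?_⟩
    rw [Ideal.absNorm_span_natCast, RingOfIntegers.rank, Module.finrank_self, pow_one]
  exact Nat.card_pos

theorem tsum_primes_div_log_bounded :
    ∀ᶠ s in 𝓝[>] (1 : ℝ),
      (∑' p : Nat.Primes, ((p : ℕ) : ℝ) ^ (-s)) / Real.log (1 / (s - 1)) ≤ 2 := by
  obtain ⟨h1, h2⟩ := tendsto_primeTerm_div_log ℚ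
  filter_upwards [h1, h2.eventually_le_const (show (1 : ℝ) < 2 by norm_num),
    self_mem_nhdsWithin, tendsto_log_one_div.eventually_gt_atTop 0] with s hs1 hs2 hs hl
  refine le_trans ?_ hs2
  gcongr 1
  refine Summable.tsum_le_tsum (fun p => ?_)
    ((Nat.Primes.summable_rpow (r := -s)).2 (by simpa using hs)) hs1
  have h3 : (1 : ℝ) ≤ idealCount ℚ p := by exact_mod_cast one_le_idealCount_rat p
  exact le_mul_of_one_le_left (Real.rpow_nonneg (by positivity) _) h3

open Classical in
/-- A set of primes of relative natural density zero has Dirichlet density zero. -/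
theorem primeMean_zero_of_natural_density (P : ℕ → Prop)
    (h : Tendsto (fun X : ℕ => (Nat.card {ℓ : ℕ // ℓ ≤ X ∧ ℓ.Prime ∧ ¬ P ℓ} : ℝ) /
      (Nat.card {ℓ : ℕ // ℓ ≤ X ∧ ℓ.Prime} : ℝ)) atTop (𝓝 1)) :
    PrimeMean (fun p => if P p then 1 else 0) 0 := by
  have hbd : ∃ B : ℝ, ∀ p : Nat.Primes, |(if P p then 1 else 0 : ℝ)| ≤ B :=
    ⟨1, fun p => by split_ifs <;> simp⟩
  refine ⟨hbd, ?_⟩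
  have hcard : ∀ (Q : ℕ → Prop) (X : ℕ), (Nat.card {ℓ : ℕ // ℓ ≤ X ∧ ℓ.Prime ∧ Q ℓ} : ℝ) =
      ∑ i ∈ Finset.range (X + 1), if i.Prime ∧ Q i then (1 : ℝ) else 0 := by
    intro Q X
    rw [Finset.sum_boole, ← Nat.card_eq_finsetCard]
    congr 1
    refine Nat.card_congr (Equiv.subtypeEquivRight fun ℓ => ?_)
    simp
  have hcard' : ∀ (X : ℕ), (Nat.card {ℓ : ℕ // ℓ ≤ X ∧ ℓ.Prime} : ℝ) =
      ∑ i ∈ Finset.range (X + 1), if i.Prime then (1 : ℝ) else 0 := by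
    intro X
    simpa using hcard (fun _ => True) X
  simp_rw [hcard, hcard'] at h
  have main : ∀ ε : ℝ, 0 < ε → ∃ D : ℝ, ∀ s : ℝ, 1 < s →
      ∑' p : Nat.Primes, (if P p then 1 else 0 : ℝ) * ((p : ℕ) : ℝ) ^ (-s) ≤
        ε * ∑' p : Nat.Primes, ((p : ℕ) : ℝ) ^ (-s) + D := by
    intro ε hε
    obtain ⟨X₀, hX₀⟩ := eventually_atTop.1 (h.eventually_const_lt (show 1 - ε < 1 by linarith))
    let c : ℕ → ℝ := fun i => if i.Prime then ((if P i then 1 else 0) - ε) else 0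
    have hc : ∀ n, ∑ i ∈ Finset.range n, c i ≤ X₀ + 2 := by
      intro n
      have hc1 : ∀ i, c i ≤ 1 := by
        intro i
        simp only [c]
        split_ifs <;> linarith
      rcases lt_or_ge n (X₀ + 2) with hn | hn
      · calc _ ≤ ∑ i ∈ Finset.range n, (1 : ℝ) := Finset.sum_le_sum fun i _ => hc1 i
          _ = n := by simp
          _ ≤ _ := by exact_mod_cast hn.le
      · obtain ⟨X, rfl⟩ : ∃ X, n = X + 1 := ⟨n - 1, by omega⟩
        have hX := hX₀ X (by omega)
        have h3 : ∑ i ∈ Finset.range (X + 1), c i =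
            (1 - ε) * (∑ i ∈ Finset.range (X + 1), if i.Prime then (1 : ℝ) else 0) -
            ∑ i ∈ Finset.range (X + 1), if i.Prime ∧ ¬ P i then (1 : ℝ) else 0 := by
          rw [Finset.mul_sum, ← Finset.sum_sub_distrib]
          refine Finset.sum_congr rfl fun i _ => ?_
          simp only [c]
          by_cases h1 : i.Prime <;> by_cases h2 : P i <;> simp [h1, h2]
        have h0 : 0 ≤ ∑ i ∈ Finset.range (X + 1), if i.Prime then (1 : ℝ) else 0 :=
          Finset.sum_nonneg fun i _ => by split_ifs <;> simp
        rcases h0.eq_or_lt with h0 | h0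
        · rw [h3, ← h0]
          have : 0 ≤ ∑ i ∈ Finset.range (X + 1), if i.Prime ∧ ¬ P i then (1 : ℝ) else 0 :=
            Finset.sum_nonneg fun i _ => by split_ifs <;> simp
          have : (0 : ℝ) ≤ X₀ := by positivity
          linarith
        · rw [lt_div_iff₀ h0] at hX
          have : (0 : ℝ) ≤ X₀ := by positivity
          rw [h3]
          refine le_trans (sub_nonpos.2 ?_) (by linarith : (0 : ℝ) ≤ X₀ + 2)
          convert hX.le using 2
          congr
    refine ⟨X₀ + 2, fun s hs => ?_⟩
    let w : ℕ → ℝ := fun i => if i = 0 then 1 else (i : ℝ) ^ (-s)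
    have hw0 : ∀ i, 0 ≤ w i := fun i => by
      simp only [w]; split_ifs <;> positivity
    have hw : Antitone w := by
      refine antitone_nat_of_succ_le fun n => ?_
      simp only [w, Nat.succ_ne_zero, if_false]
      split_ifs with hn
      · subst hn
        simp
      · exact Real.rpow_le_rpow_of_nonpos (by positivity) (by push_cast; linarith) (by linarith)
    have hpart := sum_mul_le_of_partial_sums_le hw hw0 hc
    have hs1 := summable_primes_mul hbd hs
    have hs2 : Summable fun p : Nat.Primes => ((p : ℕ) : ℝ) ^ (-s) :=
      (Nat.Primes.summable_rpow (r := -s)).2 (by linarith)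
    have heq : ∑' p : Nat.Primes, (if P p then 1 else 0 : ℝ) * ((p : ℕ) : ℝ) ^ (-s) -
        ε * ∑' p : Nat.Primes, ((p : ℕ) : ℝ) ^ (-s) =
        ∑' p : Nat.Primes, (fun i => c i * w i) (p : ℕ) := by
      rw [← tsum_mul_left, ← hs1.tsum_sub (hs2.mul_left ε)]
      refine tsum_congr fun p => ?_
      simp only [c, w, if_pos p.2, if_neg p.2.ne_zero]
      ring
    have hsum : Summable fun p : Nat.Primes => (fun i => c i * w i) (p : ℕ) := by
      refine (hs1.sub (hs2.mul_left ε)).congr fun p => ?_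
      simp only [c, w, if_pos p.2, if_neg p.2.ne_zero]
      ring
    have hsupp : Function.support (fun i => c i * w i) ⊆ {p : ℕ | p.Prime} := by
      intro i hi
      by_contra hip
      refine hi ?_
      have : ¬ i.Prime := hip
      simp [c, this]
    have h5 : HasSum (fun i => c i * w i) (∑' p : Nat.Primes, (fun i => c i * w i) (p : ℕ)) := by
      rw [← hasSum_subtype_iff_of_support_subset hsupp]
      exact hsum.hasSum
    have h6 := le_of_tendsto' h5.tendsto_sum_nat hpart
    rw [← heq] at h6
    simp only [w, if_true] at h6
    linarith
  rw [Metric.tendsto_nhds]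
  intro ε hε
  obtain ⟨D, hD⟩ := main (ε / 8) (by linarith)
  filter_upwards [self_mem_nhdsWithin, tendsto_log_one_div.eventually_gt_atTop 0,
    tsum_primes_div_log_bounded,
    (tendsto_log_one_div.const_div_atTop D).eventually_lt_const
      (show 0 < ε / 2 by linarith)] with s hs hl hb hDs
  have h1 : 0 ≤ ∑' p : Nat.Primes, (if P p then 1 else 0 : ℝ) * ((p : ℕ) : ℝ) ^ (-s) :=
    tsum_nonneg fun p => mul_nonneg (by split_ifs <;> simp) (Real.rpow_nonneg (by positivity) _)
  rw [Real.dist_eq, sub_zero, abs_of_nonneg (div_nonneg h1 hl.le)]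
  have h2 := div_le_div_of_nonneg_right (hD s hs) hl.le
  rw [add_div, mul_div_assoc] at h2
  nlinarith

theorem WeaklyIntersective.primeMean {f : ℤ[X]} (hf : WeaklyIntersective f)
    (P : ℕ → Prop) [DecidablePred P] (hP : ∀ p, P p ↔ ¬ ∃ x : ZMod p, aeval x f = 0) :
    PrimeMean (fun p => if P p then 1 else 0) 0 := by
  have := primeMean_zero_of_natural_density P (by
    simp_rw [hP, not_not]
    exact hf)
  convert this

end PrimeMean

section Frobenius

open NumberField Pointwise IntermediateField

theorem exists_finset_primes_notMem {R : Type*} [CommRing R] [IsDedekindDomain R]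
    [Module.Free ℤ R] [Module.Finite ℤ R] [CharZero R] {δ : R} (hδ : δ ≠ 0) :
    ∃ S : Finset Nat.Primes, ∀ p ∉ S, ∀ P : Ideal R, P ≠ ⊤ → ((p : ℕ) : R) ∈ P → δ ∉ P := by
  classical
  have hn : Ideal.absNorm (Ideal.span {δ}) ≠ 0 := by
    rwa [Ne, Ideal.absNorm_eq_zero_iff, Ideal.span_singleton_eq_bot]
  set n := Ideal.absNorm (Ideal.span {δ}) with hn'
  have hfin : {p : Nat.Primes | (p : ℕ) ∈ n.primeFactors}.Finite :=
    (n.primeFactors.finite_toSet).preimage Subtype.val_injective.injOn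
  refine ⟨hfin.toFinset, fun p hp P hP hpP hδP => hP ?_⟩
  have hpn : ¬ (p : ℕ) ∣ n := fun h => hp (by simpa using ⟨p.2, h, hn⟩)
  have h1 : (n : R) ∈ P :=
    ((Ideal.span_singleton_le_iff_mem P).2 hδP) (Ideal.absNorm_mem (Ideal.span {δ}))
  have h2 : IsCoprime ((p : ℕ) : ℤ) (n : ℤ) :=
    Nat.isCoprime_iff_coprime.2 ((Nat.Prime.coprime_iff_not_dvd p.2).2 hpn)
  obtain ⟨a, b, hab⟩ := h2
  rw [Ideal.eq_top_iff_one]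
  have h3 : (a : R) * ((p : ℕ) : R) + (b : R) * (n : R) = 1 := by exact_mod_cast congrArg Int.cast hab
  rw [← h3]
  exact P.add_mem (P.mul_mem_left _ hpP) (P.mul_mem_left _ h1)

theorem exists_int_sub_mem_of_card {R : Type*} [CommRing R] {p : ℕ} (hp : p.Prime) {I : Ideal R}
    (hI : Nat.card (R ⧸ I) = p) (a : R) : ∃ m : ℤ, a - m ∈ I := by
  have : Fact p.Prime := ⟨hp⟩
  have : Finite (R ⧸ I) := Nat.finite_of_card_ne_zero (by rw [hI]; exact hp.ne_zero)
  have h2 : IsAddCyclic (R ⧸ I) := isAddCyclic_of_prime_card hI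
  have h1 : (1 : R ⧸ I) ≠ 0 := by
    intro h
    have : Subsingleton (R ⧸ I) := subsingleton_of_zero_eq_one h.symm
    rw [Nat.card_of_subsingleton (1 : R ⧸ I)] at hI
    exact hp.one_lt.ne hI
  have h3 : AddSubgroup.zmultiples (1 : R ⧸ I) = ⊤ := zmultiples_eq_top_of_prime_card hI h1
  have h4 : Ideal.Quotient.mk I a ∈ AddSubgroup.zmultiples (1 : R ⧸ I) := by rw [h3]; trivial
  obtain ⟨m, hm⟩ := AddSubgroup.mem_zmultiples_iff.1 h4
  refine ⟨m, ?_⟩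
  rw [← Ideal.Quotient.eq, map_intCast, ← hm]
  simp

theorem exists_zmod_cast_eq_of_pow_eq {D : Type*} [CommRing D] [IsDomain D] {p : ℕ}
    (hp : p.Prime) [CharP D p] {y : D} (hy : y ^ p = y) : ∃ b : ZMod p, ZMod.castHom dvd_rfl D b = y := by
  classical
  have : Fact p.Prime := ⟨hp⟩
  by_contra! hne
  let φ : ZMod p →+* D := ZMod.castHom dvd_rfl _
  have hφ : Function.Injective φ := φ.injective
  have hdeg : (X ^ p - X : D[X]).natDegree = p := by
    rw [natDegree_sub_eq_left_of_natDegree_lt] <;> simp [hp.one_lt]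
  have hne0 : (X ^ p - X : D[X]) ≠ 0 := by
    intro h
    rw [h, natDegree_zero] at hdeg
    exact hp.ne_zero hdeg.symm
  have hsub : (insert y (Finset.univ.image φ)).val ⊆ (X ^ p - X : D[X]).roots := by
    intro z hz
    rw [mem_roots hne0, IsRoot.def]
    simp only [eval_sub, eval_pow, eval_X]
    rw [Finset.mem_val, Finset.mem_insert] at hz
    rcases hz with rfl | hz
    · rw [hy, sub_self]
    · obtain ⟨b, -, rfl⟩ := Finset.mem_image.1 hz
      rw [← map_pow, ZMod.pow_card, sub_self]
  have h1 := card_le_degree_of_subset_roots hsub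
  rw [Finset.card_insert_of_notMem (by simpa [φ] using hne), Finset.card_image_of_injective _ hφ,
    Finset.card_univ, ZMod.card, hdeg] at h1
  omega

theorem card_quotient_of_pow_sub_mem {R : Type*} [CommRing R] {p : ℕ} (hp : p.Prime) {I : Ideal R}
    [I.IsPrime] (hpI : (p : R) ∈ I) (h : ∀ a : R, a ^ p - a ∈ I) : Nat.card (R ⧸ I) = p := by
  have : Fact p.Prime := ⟨hp⟩
  have hchar : CharP (R ⧸ I) p := by
    rw [CharP.charP_iff_prime_eq_zero hp, ← map_natCast (Ideal.Quotient.mk I),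
      Ideal.Quotient.eq_zero_iff_mem]
    exact hpI
  let φ : ZMod p →+* R ⧸ I := ZMod.castHom dvd_rfl _
  have hφs : Function.Surjective φ := by
    intro y
    obtain ⟨b, rfl⟩ := Ideal.Quotient.mk_surjective y
    refine exists_zmod_cast_eq_of_pow_eq hp ?_
    rw [← map_pow, Ideal.Quotient.eq]
    exact h b
  rw [← Nat.card_congr (Equiv.ofBijective φ ⟨φ.injective, hφs⟩), Nat.card_zmod]

variable (K : Type*) [Field K] [NumberField K] (H : Subgroup (K ≃ₐ[ℚ] K))

variable {K} in
theorem exists_integer_smul_ne {g : K ≃ₐ[ℚ] K} (hg : g ∉ H) :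
    ∃ a : 𝓞 (fixedField H), g • algebraMap _ (𝓞 K) a ≠ algebraMap _ (𝓞 K) a := by
  by_contra! h
  refine hg ?_
  rw [← IntermediateField.fixingSubgroup_fixedField H, IntermediateField.mem_fixingSubgroup_iff]
  intro x hx
  obtain ⟨a, b, -, hab⟩ := IsFractionRing.div_surjective (A := 𝓞 (fixedField H)) (⟨x, hx⟩ : fixedField H)
  have hab' : ((a : fixedField H) : K) / ((b : fixedField H) : K) = x := congrArg Subtype.val hab
  have ha : g ((a : fixedField H) : K) = ((a : fixedField H) : K) := congrArg Subtype.val (h a)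
  have hb : g ((b : fixedField H) : K) = ((b : fixedField H) : K) := congrArg Subtype.val (h b)
  rw [← hab', map_div₀, ha, hb]

variable {K} in
theorem smul_algebraMap_eq {g : K ≃ₐ[ℚ] K} (hg : g ∈ H) (a : 𝓞 (fixedField H)) :
    g • algebraMap _ (𝓞 K) a = algebraMap _ (𝓞 K) a := by
  ext
  exact (a : fixedField H).2 ⟨g, hg⟩

/-- The conjugates of the integers of `fixedField H` stay distinct modulo almost all primes. -/
theorem exists_finset_smul_sub_smul_notMem :
    ∃ S : Finset Nat.Primes, ∀ p ∉ S, ∀ P : Ideal (𝓞 K), P ≠ ⊤ → ((p : ℕ) : 𝓞 K) ∈ P →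
      ∀ x y : K ≃ₐ[ℚ] K, x⁻¹ * y ∉ H → ∃ a : 𝓞 (fixedField H),
        y • algebraMap _ (𝓞 K) a - x • algebraMap _ (𝓞 K) a ∉ P := by
  classical
  have key : ∀ z : (K ≃ₐ[ℚ] K) × (K ≃ₐ[ℚ] K), ∃ S : Finset Nat.Primes, ∀ p ∉ S,
      ∀ P : Ideal (𝓞 K), P ≠ ⊤ → ((p : ℕ) : 𝓞 K) ∈ P → z.1⁻¹ * z.2 ∉ H →
      ∃ a : 𝓞 (fixedField H), z.2 • algebraMap _ (𝓞 K) a - z.1 • algebraMap _ (𝓞 K) a ∉ P := by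
    rintro ⟨x, y⟩
    by_cases hxy : x⁻¹ * y ∈ H
    · exact ⟨∅, fun _ _ _ _ _ h => absurd hxy h⟩
    · obtain ⟨a, ha⟩ := exists_integer_smul_ne H hxy
      have hδ : y • algebraMap _ (𝓞 K) a - x • algebraMap _ (𝓞 K) a ≠ 0 := by
        rw [sub_ne_zero]
        intro h
        apply ha
        rw [mul_smul, h, inv_smul_smul]
      obtain ⟨S, hS⟩ := exists_finset_primes_notMem hδ
      exact ⟨S, fun p hp P hP hpP _ => ⟨a, hS p hp P hP hpP⟩⟩
  choose S hS using key
  refine ⟨Finset.univ.biUnion S, fun p hp P hP hpP x y hxy => hS (x, y) p (fun h => hp ?_) P hP hpP hxy⟩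
  exact Finset.mem_biUnion.2 ⟨_, Finset.mem_univ _, h⟩

/-- For almost all primes `p`, the number of ideals of norm `p` in the fixed field of `H` is the
number of fixed points of a Frobenius element on the cosets of `H`. -/
theorem exists_finset_idealCount_mul_card [IsGalois ℚ K] :
    ∃ S : Finset Nat.Primes, ∀ p ∉ S, ∀ P : Ideal (𝓞 K), P.IsPrime → ((p : ℕ) : 𝓞 K) ∈ P →
      ∀ σ : K ≃ₐ[ℚ] K, (∀ x : 𝓞 K, σ • x - x ^ (p : ℕ) ∈ P) →
      idealCount (fixedField H) p * Nat.card H = Nat.card {x : K ≃ₐ[ℚ] K // x⁻¹ * σ * x ∈ H} := by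
  obtain ⟨S, hS⟩ := exists_finset_smul_sub_smul_notMem K H
  refine ⟨S, fun p hpS P hP hpP σ hσ => ?_⟩
  have hp : (p : ℕ).Prime := p.2
  have hgood := hS p hpS P hP.ne_top hpP
  set ι := algebraMap (𝓞 (fixedField H)) (𝓞 K) with hι
  let Q : (K ≃ₐ[ℚ] K) → Ideal (𝓞 (fixedField H)) := fun x =>
    P.comap ((MulSemiringAction.toRingHom _ (𝓞 K) x).comp ι)
  have hQ : ∀ x a, a ∈ Q x ↔ x • ι a ∈ P := fun x a => Iff.rfl
  have hQP : ∀ x, (Q x).IsPrime := fun x => Ideal.comap_isPrime _ _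
  have smul_int : ∀ (x : K ≃ₐ[ℚ] K) (m : ℤ), x • (m : 𝓞 K) = m := fun x m =>
    map_intCast (MulSemiringAction.toRingHom _ (𝓞 K) x) m
  have hA : ∀ x, ∀ h ∈ H, Q (x * h) = Q x := by
    intro x h hh
    ext a
    rw [hQ, hQ, mul_smul, smul_algebraMap_eq H hh]
  have hpQ : ∀ x, ((p : ℕ) : 𝓞 (fixedField H)) ∈ Q x := by
    intro x
    have := smul_int x (p : ℕ)
    push_cast at this
    rwa [hQ, map_natCast, this]
  have hC : ∀ x, x⁻¹ * σ * x ∈ H → Ideal.absNorm (Q x) = p := by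
    intro x hx
    rw [Ideal.absNorm_apply, Submodule.cardQuot_apply]
    have := hQP x
    refine card_quotient_of_pow_sub_mem hp (hpQ x) fun a => ?_
    rw [hQ, map_sub, map_pow, smul_sub, smul_pow']
    have h1 : σ • x • ι a = x • ι a := by
      have := smul_algebraMap_eq H hx a
      rw [mul_assoc, mul_smul, inv_smul_eq_iff, mul_smul] at this
      exact this
    have := hσ (x • ι a)
    rw [h1] at this
    rw [← neg_sub]
    exact P.neg_mem this
  have hcong : ∀ x, Ideal.absNorm (Q x) = p → ∀ a : 𝓞 (fixedField H), ∃ m : ℤ, a - m ∈ Q x := by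
    intro x hx a
    rw [Ideal.absNorm_apply, Submodule.cardQuot_apply] at hx
    exact exists_int_sub_mem_of_card hp hx a
  have hsub : ∀ x (a : 𝓞 (fixedField H)) (m : ℤ), a - m ∈ Q x → x • ι a - m ∈ P := by
    intro x a m h
    rwa [hQ, map_sub, map_intCast, smul_sub, smul_int] at h
  have hD : ∀ x, Ideal.absNorm (Q x) = p → x⁻¹ * σ * x ∈ H := by
    intro x hx
    by_contra hn
    rw [mul_assoc] at hn
    obtain ⟨a, ha⟩ := hgood x (σ * x) hn
    obtain ⟨m, hm⟩ := hcong x hx a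
    have hu := hsub x a m hm
    have hu' : σ • (x • ι a - m) ∈ P := by
      have := P.add_mem (hσ (x • ι a - m)) (P.pow_mem_of_mem hu p hp.pos)
      rwa [sub_add_cancel] at this
    rw [smul_sub, smul_int] at hu'
    refine ha ?_
    have := P.sub_mem hu' hu
    rwa [sub_sub_sub_cancel_right, ← mul_smul] at this
  have hE : ∀ x y, Ideal.absNorm (Q x) = p → Q x = Q y → x⁻¹ * y ∈ H := by
    intro x y hx hxy
    by_contra hn
    obtain ⟨a, ha⟩ := hgood x y hn
    obtain ⟨m, hm⟩ := hcong x hx a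
    have := P.sub_mem (hsub y a m (hxy ▸ hm)) (hsub x a m hm)
    rw [sub_sub_sub_cancel_right] at this
    exact ha this
  have hF : ∀ I : Ideal (𝓞 (fixedField H)), Ideal.absNorm I = p → ∃ x, Q x = I := by
    intro I hI
    have hIP : I.IsPrime := Ideal.isPrime_of_irreducible_absNorm (by rw [hI]; exact hp)
    obtain ⟨Q', -, hQ', hQI⟩ := Ideal.exists_ideal_over_prime_of_isIntegral (S := 𝓞 K) I ⊥ (by
      intro a ha
      rw [Ideal.mem_comap, Ideal.mem_bot, map_eq_zero_iff _
        (FaithfulSMul.algebraMap_injective _ _)] at ha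
      exact ha ▸ I.zero_mem)
    have : Fact (p : ℕ).Prime := ⟨hp⟩
    have hmax := Int.ideal_span_isMaximal_of_prime p
    have hunder : ∀ P' : Ideal (𝓞 K), P'.IsPrime → ((p : ℕ) : 𝓞 K) ∈ P' →
        Ideal.span {((p : ℕ) : ℤ)} = Ideal.under ℤ P' := by
      intro P' hP' hpP'
      refine hmax.eq_of_le (Ideal.IsPrime.ne_top (Ideal.IsPrime.under ℤ P')) ?_
      rw [Ideal.span_singleton_le_iff_mem, Ideal.mem_comap]
      simpa using hpP'
    have hpQ' : ((p : ℕ) : 𝓞 K) ∈ Q' := by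
      have h1 := Ideal.absNorm_mem I
      rw [hI, ← hQI, Ideal.mem_comap, map_natCast] at h1
      exact h1
    obtain ⟨g, hg⟩ := Algebra.IsInvariant.exists_smul_of_under_eq ℤ (𝓞 K) (K ≃ₐ[ℚ] K) P Q'
      ((hunder P hP hpP).symm.trans (hunder Q' hQ' hpQ'))
    refine ⟨g⁻¹, ?_⟩
    ext a
    rw [hQ, ← hQI, Ideal.mem_comap, hg, Ideal.mem_pointwise_smul_iff_inv_smul_mem]
  choose s hs using fun I : {I : Ideal (𝓞 (fixedField H)) // Ideal.absNorm I = p} => hF I.1 I.2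
  have hsN : ∀ I, Ideal.absNorm (Q (s I)) = p := fun I => by rw [hs]; exact I.2
  let Ψ : {I : Ideal (𝓞 (fixedField H)) // Ideal.absNorm I = p} × H →
      {x : K ≃ₐ[ℚ] K // x⁻¹ * σ * x ∈ H} := fun z =>
    ⟨s z.1 * z.2, hD _ (by rw [hA _ _ z.2.2]; exact hsN _)⟩
  have hΨ : Function.Bijective Ψ := by
    constructor
    · rintro ⟨I, h⟩ ⟨I', h'⟩ hz
      have h1 : s I * h = s I' * h' := congrArg Subtype.val hz
      have h2 : I = I' := by
        have := congrArg Q h1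
        rw [hA _ _ h.2, hA _ _ h'.2, hs, hs] at this
        exact Subtype.ext this
      subst h2
      rw [mul_left_cancel_iff] at h1
      rw [Subtype.ext h1]
    · rintro ⟨x, hx⟩
      have hI := hC x hx
      refine ⟨(⟨Q x, hI⟩, ⟨(s ⟨Q x, hI⟩)⁻¹ * x, hE _ _ (hsN _) (hs _)⟩), ?_⟩
      exact Subtype.ext (mul_inv_cancel_left _ _)
  rw [idealCount, ← Nat.card_prod, Nat.card_congr (Equiv.ofBijective Ψ hΨ)]

end Frobenius

section Frobenius

open NumberField Pointwise IntermediateField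

theorem exists_frobenius (K : Type*) [Field K] [NumberField K] [IsGalois ℚ K] {p : ℕ}
    (hp : p.Prime) : ∃ P : Ideal (𝓞 K), P.IsPrime ∧ (p : 𝓞 K) ∈ P ∧
      ∃ σ : K ≃ₐ[ℚ] K, ∀ x : 𝓞 K, σ • x - x ^ p ∈ P := by
  have : Fact p.Prime := ⟨hp⟩
  have hmax := Int.ideal_span_isMaximal_of_prime p
  have := hmax.isPrime
  obtain ⟨P, -, hP, hPp⟩ := Ideal.exists_ideal_over_prime_of_isIntegral (S := 𝓞 K)
    (Ideal.span {(p : ℤ)}) ⊥ (by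
      intro a ha
      rw [Ideal.mem_comap, Ideal.mem_bot, map_eq_zero_iff _
        (FaithfulSMul.algebraMap_injective _ _)] at ha
      exact ha ▸ Ideal.zero_mem _)
  have hpP : (p : 𝓞 K) ∈ P := by
    have : (p : ℤ) ∈ P.comap (algebraMap ℤ (𝓞 K)) := by
      rw [hPp]; exact Ideal.mem_span_singleton_self _
    simpa using this
  have hP0 : P ≠ ⊥ := by
    rintro rfl
    exact hp.ne_zero (by exact_mod_cast (Ideal.mem_bot.1 hpP : (p : 𝓞 K) = 0))
  have : Finite (𝓞 K ⧸ P) := Ideal.finiteQuotientOfFreeOfNeBot P hP0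
  obtain ⟨σ, hσ⟩ := IsArithFrobAt.exists_of_isInvariant ℤ (K ≃ₐ[ℚ] K) P
  refine ⟨P, hP, hpP, σ, fun x => ?_⟩
  have hcard : Nat.card (ℤ ⧸ P.under ℤ) = p := by
    change Nat.card (ℤ ⧸ P.comap (algebraMap ℤ (𝓞 K))) = p
    rw [hPp, Nat.card_congr (Int.quotientSpanNatEquivZMod p).toEquiv, Nat.card_zmod]
  have := hσ x
  rwa [hcard] at this

theorem natCard_mem_eq_sum {G : Type*} [Group G] [Finite G] [Fintype (Subgroup G)]
    [DecidableEq (Subgroup G)] [DecidableRel fun H' H : Subgroup G => H' ≤ H] (u : G → G)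
    (H : Subgroup G) : Nat.card {x // u x ∈ H} =
      ∑ H' with H' ≤ H, Nat.card {x // Subgroup.zpowers (u x) = H'} := by
  classical
  have := Fintype.ofFinite G
  simp_rw [Nat.card_eq_fintype_card, Fintype.card_subtype]
  rw [Finset.card_eq_sum_card_fiberwise (f := fun x => Subgroup.zpowers (u x))
    (t := Finset.univ.filter fun H' => H' ≤ H)]
  · refine Finset.sum_congr rfl fun H' hH' => congrArg Finset.card ?_
    ext x
    simp only [Finset.mem_filter, Finset.mem_univ, true_and, and_iff_right_iff_imp] at hH' ⊢
    rintro rfl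
    exact hH' (Subgroup.mem_zpowers _)
  · intro x hx
    simpa using hx

/-- If conjugates of `σ p` lie in every subgroup with the expected frequency, then they generate
every subgroup with the expected frequency. -/
theorem primeMean_zpowers_eq {G : Type*} [Group G] [Finite G] (σ : Nat.Primes → G)
    (h : ∀ H : Subgroup G, PrimeMean
      (fun p => (Nat.card {x // x⁻¹ * σ p * x ∈ H} : ℝ)) (Nat.card H)) (H : Subgroup G) :
    PrimeMean (fun p => (Nat.card {x // Subgroup.zpowers (x⁻¹ * σ p * x) = H} : ℝ))
      (Nat.card {x // Subgroup.zpowers x = H}) := by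
  classical
  have := Fintype.ofFinite (Subgroup G)
  induction H using WellFoundedLT.induction with
  | ind H ih =>
    have h1 := h H
    have h2 : Nat.card H = Nat.card {x // id x ∈ H} := rfl
    rw [h2, natCard_mem_eq_sum] at h1
    simp_rw [natCard_mem_eq_sum (fun x => x⁻¹ * σ _ * x) H] at h1
    have hH : H ∈ Finset.univ.filter fun H' => H' ≤ H := by simp
    have h3 := h1.add ((PrimeMean.sum ((Finset.univ.filter fun H' => H' ≤ H).erase H)
      fun H' hH' => ih H' (by
        simp only [Finset.mem_erase, Finset.mem_filter, Finset.mem_univ, true_and] at hH'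
        exact lt_of_le_of_ne hH'.2 hH'.1)).const_mul (-1))
    push_cast at h3
    simp_rw [← Finset.add_sum_erase _ _ hH] at h3
    convert h3 using 1
    · funext p; ring
    · simp only [id]; ring

variable (K : Type*) [Field K] [NumberField K] [IsGalois ℚ K]

theorem primeMean_conj_mem (P : Nat.Primes → Ideal (𝓞 K)) (hP : ∀ p, (P p).IsPrime)
    (hpP : ∀ p : Nat.Primes, ((p : ℕ) : 𝓞 K) ∈ P p) (σ : Nat.Primes → (K ≃ₐ[ℚ] K))
    (hσ : ∀ (p : Nat.Primes) (x : 𝓞 K), σ p • x - x ^ (p : ℕ) ∈ P p)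
    (H : Subgroup (K ≃ₐ[ℚ] K)) :
    PrimeMean (fun p => (Nat.card {x // x⁻¹ * σ p * x ∈ H} : ℝ)) (Nat.card H) := by
  obtain ⟨S, hS⟩ := exists_finset_idealCount_mul_card K H
  have hH : (Nat.card H : ℝ) ≠ 0 := by exact_mod_cast Nat.card_pos.ne'
  have h1 : PrimeMean (fun p => (Nat.card {x // x⁻¹ * σ p * x ∈ H} : ℝ) / Nat.card H) 1 := by
    refine primeMean_of_idealCount (fixedField H)
      ⟨(Nat.card (K ≃ₐ[ℚ] K) : ℝ) / Nat.card H, fun p => ?_⟩ S fun p hp => ?_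
    · rw [abs_of_nonneg (by positivity)]
      gcongr
      exact Finite.card_subtype_le _
    · rw [div_eq_iff hH, ← hS p hp (P p) (hP p) (hpP p) (σ p) (hσ p)]
      push_cast
      rfl
  have h2 := h1.const_mul (Nat.card H : ℝ)
  rw [mul_one] at h2
  convert h2 using 2
  rw [mul_div_cancel₀ _ hH]

end Frobenius

section RootsModPrimes

open NumberField Pointwise

theorem aeval_intCast_eq {S : Type*} [CommRing S] (g : ℤ[X]) (m : ℤ) :
    aeval (m : S) g = ((g.eval m : ℤ) : S) := by
  rw [aeval_def, eval₂_at_intCast, eq_intCast, Int.cast_id]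

theorem eval_mem_iff_aeval_zmod {S : Type*} [CommRing S] {p : ℕ} [Fact p.Prime] {P : Ideal S}
    [P.IsPrime] (hp : (p : S) ∈ P) (g : ℤ[X]) (m : ℤ) :
    aeval (m : ZMod p) g = 0 ↔ aeval (m : S) g ∈ P := by
  have hchar : CharP (S ⧸ P) p := by
    rw [CharP.charP_iff_prime_eq_zero Fact.out, ← map_natCast (Ideal.Quotient.mk P),
      Ideal.Quotient.eq_zero_iff_mem]
    exact hp
  rw [aeval_intCast_eq, aeval_intCast_eq, ZMod.intCast_zmod_eq_zero_iff_dvd,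
    ← Ideal.Quotient.eq_zero_iff_mem, map_intCast, CharP.intCast_eq_zero_iff _ p]

/-- If a monic integer polynomial has a root modulo a set of primes of Dirichlet density one, it
has a root modulo almost all primes. -/
theorem exists_finset_root_of_splits (K : Type*) [Field K] [NumberField K] [IsGalois ℚ K]
    {g : ℤ[X]} (hg : g.Monic) (hgK : (g.map (algebraMap ℤ K)).Splits)
    {φ : Nat.Primes → ℝ} (hφ0 : PrimeMean φ 0) (S₀ : Finset Nat.Primes)
    (hφ1 : ∀ p ∉ S₀, (∀ x : ZMod p, aeval x g ≠ 0) → 1 ≤ φ p) (hφ : ∀ p, 0 ≤ φ p) :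
    ∃ S : Finset Nat.Primes, ∀ p ∉ S, ∃ x : ZMod p, aeval x g = 0 := by
  classical
  have hsplit : (g.map (algebraMap ℤ (𝓞 K))).Splits := by
    have h1 : (g.map (algebraMap ℤ (𝓞 K))).map (algebraMap (𝓞 K) K) = g.map (algebraMap ℤ K) := by
      rw [map_map, ← IsScalarTower.algebraMap_eq]
    refine Splits.of_splits_map_of_injective (FaithfulSMul.algebraMap_injective (𝓞 K) K)
      (h1 ▸ hgK) fun a ha => ?_
    rw [h1] at ha
    have h_int : IsIntegral ℤ a := by
      refine ⟨g, hg, ?_⟩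
      have := isRoot_of_mem_roots ha
      rwa [IsRoot.def, eval_map] at this
    exact ⟨⟨a, h_int⟩, rfl⟩
  have hgm : (g.map (algebraMap ℤ (𝓞 K))).Monic := hg.map _
  set r := (g.map (algebraMap ℤ (𝓞 K))).roots with hr
  have hprod : ∀ x : 𝓞 K, aeval x g = (r.map (x - ·)).prod := fun x => by
    rw [← hsplit.eval_eq_prod_roots_of_monic hgm, eval_map_algebraMap]
  have hGr : ∀ (τ : K ≃ₐ[ℚ] K), ∀ a ∈ r, τ • a ∈ r := by
    intro τ a ha
    rw [hr, mem_roots hgm.ne_zero, IsRoot.def, eval_map_algebraMap] at ha ⊢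
    have := congrArg (MulSemiringAction.toRingHom (K ≃ₐ[ℚ] K) (𝓞 K) τ) ha
    rw [map_zero, aeval_def, hom_eval₂] at this
    rw [aeval_def, ← this]
    congr 1
    exact RingHom.ext_int _ _
  choose P hP hpP σ hσ using fun p : Nat.Primes => exists_frobenius K p.2
  obtain ⟨S, hS⟩ : ∃ S : Finset Nat.Primes, ∀ p ∉ S, ∀ a ∈ r, ∀ b ∈ r, a - b ∈ P p → a = b := by
    have key : ∀ z : 𝓞 K × 𝓞 K, ∃ S : Finset Nat.Primes, ∀ p ∉ S, z.1 - z.2 ∈ P p → z.1 = z.2 := by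
      rintro ⟨a, b⟩
      by_cases hab : a = b
      · exact ⟨∅, fun _ _ _ => hab⟩
      · obtain ⟨S, hS⟩ := exists_finset_primes_notMem (sub_ne_zero.2 hab)
        exact ⟨S, fun p hp h => absurd h (hS p hp (P p) (hP p).ne_top (hpP p))⟩
    choose S hS using key
    refine ⟨(r.toFinset ×ˢ r.toFinset).biUnion S,
      fun p hp a ha b hb h => hS (a, b) p (fun hp' => ?_) h⟩
    exact hp (Finset.mem_biUnion.2 ⟨(a, b), by simp [ha, hb], hp'⟩)
  have hfix : ∀ τ : K ≃ₐ[ℚ] K, ∃ a ∈ r, τ • a = a := by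
    intro τ
    by_contra! hτ
    have h1 := primeMean_zpowers_eq σ (primeMean_conj_mem K P hP hpP σ hσ) (Subgroup.zpowers τ)
    set ψ : Nat.Primes → ℝ := fun p =>
      (Nat.card {x // Subgroup.zpowers (x⁻¹ * σ p * x) = Subgroup.zpowers τ} : ℝ)
    have hle : ∀ p ∉ S ∪ S₀, ψ p ≤ Nat.card (K ≃ₐ[ℚ] K) * φ p := by
      intro p hp
      rw [Finset.notMem_union] at hp
      rcases isEmpty_or_nonempty
        {x // Subgroup.zpowers (x⁻¹ * σ p * x) = Subgroup.zpowers τ} with he | ⟨x, hx⟩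
      · simp only [ψ, Nat.card_of_isEmpty, Nat.cast_zero]
        have := hφ p
        positivity
      · have h2 : 1 ≤ φ p := by
          refine hφ1 p hp.2 fun y hy => ?_
          obtain ⟨m, rfl⟩ := ZMod.intCast_surjective y
          have : Fact (p : ℕ).Prime := ⟨p.2⟩
          have := hP p
          rw [eval_mem_iff_aeval_zmod (hpP p), hprod,
            (hP p).multiset_prod_mem_iff_exists_mem] at hy
          obtain ⟨b, hb, hbP⟩ := hy
          obtain ⟨a, ha, rfl⟩ := Multiset.mem_map.1 hb
          have h3 : σ p • (m - a) ∈ P p := by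
            have := (P p).add_mem (hσ p (m - a)) ((P p).pow_mem_of_mem hbP p p.2.pos)
            rwa [sub_add_cancel] at this
          have h4 : σ p • (m : 𝓞 K) = m :=
            map_intCast (MulSemiringAction.toRingHom _ (𝓞 K) (σ p)) m
          rw [smul_sub, h4] at h3
          have h5 := (P p).sub_mem hbP h3
          rw [sub_sub_sub_cancel_left] at h5
          have h6 := hS p hp.1 _ (hGr _ _ ha) _ ha h5
          have h7 : τ ∈ Subgroup.zpowers (x⁻¹ * σ p * x) := hx ▸ Subgroup.mem_zpowers τ
          have h8 : x⁻¹ * σ p * x ∈ MulAction.stabilizer (K ≃ₐ[ℚ] K) (x⁻¹ • a) := by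
            rw [MulAction.mem_stabilizer_iff, ← mul_smul, mul_assoc, mul_assoc, mul_inv_cancel,
              mul_one, mul_smul, h6]
          have h9 := (Subgroup.zpowers_le.2 h8) h7
          exact hτ _ (hGr _ _ ha) (MulAction.mem_stabilizer_iff.1 h9)
        calc ψ p ≤ Nat.card (K ≃ₐ[ℚ] K) := by
              simp only [ψ]
              exact_mod_cast Finite.card_subtype_le _
          _ ≤ _ := le_mul_of_one_le_right (by positivity) h2
    have h2 := (hφ0.const_mul (Nat.card (K ≃ₐ[ℚ] K) : ℝ)).add (primeMean_of_finite_support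
      (φ := fun p => if p ∈ S ∪ S₀ then ψ p else 0) (S ∪ S₀) fun p hp => if_neg hp)
    have h3 := h1.le h2 fun p => by
      have h0 : 0 ≤ (Nat.card (K ≃ₐ[ℚ] K) : ℝ) * φ p := mul_nonneg (by positivity) (hφ p)
      split_ifs with hp
      · linarith
      · linarith [hle p hp]
    have h4 : 0 < Nat.card {x // Subgroup.zpowers x = Subgroup.zpowers τ} :=
      have : Nonempty {x // Subgroup.zpowers x = Subgroup.zpowers τ} := ⟨⟨τ, rfl⟩⟩
      Nat.card_pos
    have h5 : (0 : ℝ) < Nat.card {x // Subgroup.zpowers x = Subgroup.zpowers τ} := by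
      exact_mod_cast h4
    linarith
  refine ⟨∅, fun p _ => ?_⟩
  obtain ⟨a, ha, hσa⟩ := hfix (σ p)
  have h1 := hσ p a
  rw [hσa] at h1
  have : Fact (p : ℕ).Prime := ⟨p.2⟩
  have := hP p
  have hchar : CharP (𝓞 K ⧸ P p) p := by
    rw [CharP.charP_iff_prime_eq_zero p.2, ← map_natCast (Ideal.Quotient.mk (P p)),
      Ideal.Quotient.eq_zero_iff_mem]
    exact hpP p
  obtain ⟨b, hb⟩ := exists_zmod_cast_eq_of_pow_eq (D := 𝓞 K ⧸ P p) p.2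
    (y := Ideal.Quotient.mk _ a) (by rw [← map_pow, eq_comm, Ideal.Quotient.eq]; exact h1)
  obtain ⟨m, rfl⟩ := ZMod.intCast_surjective b
  refine ⟨m, ?_⟩
  rw [eval_mem_iff_aeval_zmod (hpP p), hprod, (hP p).multiset_prod_mem_iff_exists_mem]
  refine ⟨_, Multiset.mem_map_of_mem _ ha, ?_⟩
  rw [← Ideal.Quotient.eq, ← hb, map_intCast, map_intCast]

/-- A weakly intersective polynomial has a root modulo all but finitely many primes. -/
theorem WeaklyIntersective.exists_root {f : ℤ[X]} (hf : WeaklyIntersective f)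
    (hdeg : 1 ≤ f.natDegree) :
    ∃ S : Finset Nat.Primes, ∀ p ∉ S, ∃ x : ZMod p, aeval x f = 0 := by
  classical
  have hlc : f.leadingCoeff ≠ 0 := by
    rw [leadingCoeff_ne_zero]; rintro rfl; simp at hdeg
  set g := integralNormalization f
  have hg : g.Monic := monic_integralNormalization (by rintro rfl; simp at hdeg)
  have hK : NumberField (SplittingField (g.map (algebraMap ℤ ℚ))) :=
    { to_charZero := charZero_of_injective_algebraMap (algebraMap ℚ _).injective
      to_finiteDimensional := inferInstance }
  have hsplit : IsSplittingField ℚ (SplittingField (g.map (algebraMap ℤ ℚ)))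
      (g.map (algebraMap ℤ ℚ)) := by
    convert IsSplittingField.splittingField (g.map (algebraMap ℤ ℚ))
    exact Subsingleton.elim _ _
  have hnormal : Normal ℚ (SplittingField (g.map (algebraMap ℤ ℚ))) :=
    Normal.of_isSplittingField (g.map (algebraMap ℤ ℚ))
  have hgal : IsGalois ℚ (SplittingField (g.map (algebraMap ℤ ℚ))) := ⟨⟩
  have hfin : {p : Nat.Primes | (p : ℕ) ∈ f.leadingCoeff.natAbs.primeFactors}.Finite :=
    (Finset.finite_toSet _).preimage Subtype.val_injective.injOn
  have hpl : ∀ p ∉ hfin.toFinset, (f.leadingCoeff : ZMod p) ≠ 0 := by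
    intro p hp h
    rw [ZMod.intCast_zmod_eq_zero_iff_dvd] at h
    refine hp ?_
    simp only [Set.Finite.mem_toFinset, Set.mem_ofPred_eq, Nat.mem_primeFactors]
    exact ⟨p.2, Int.natCast_dvd.1 h, Int.natAbs_ne_zero.2 hlc⟩
  have hrel : ∀ (p : Nat.Primes) (x : ZMod p), aeval ((f.leadingCoeff : ZMod p) * x) g =
      (f.leadingCoeff : ZMod p) ^ (f.natDegree - 1) * aeval x f := fun p x => by
    have := integralNormalization_eval₂_leadingCoeff_mul hdeg (algebraMap ℤ (ZMod p)) x
    simpa only [eq_intCast, ← aeval_def] using this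
  have hsplits : (g.map (algebraMap ℤ (SplittingField (g.map (algebraMap ℤ ℚ))))).Splits := by
    have := SplittingField.splits (g.map (algebraMap ℤ ℚ))
    rwa [map_map, ← IsScalarTower.algebraMap_eq] at this
  obtain ⟨S, hS⟩ := exists_finset_root_of_splits (SplittingField (g.map (algebraMap ℤ ℚ)))
    hg hsplits (hf.primeMean _ fun p => Iff.rfl) hfin.toFinset (by
      intro p hp hx
      rw [if_pos]
      rintro ⟨x, hfx⟩
      exact hx ((f.leadingCoeff : ZMod p) * x) (by rw [hrel, hfx, mul_zero])) (fun p => by split_ifs <;> simp)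
  refine ⟨S ∪ hfin.toFinset, fun p hp => ?_⟩
  rw [Finset.notMem_union] at hp
  obtain ⟨x, hx⟩ := hS p hp.1
  have : Fact (p : ℕ).Prime := ⟨p.2⟩
  have h0 := hpl p hp.2
  refine ⟨(f.leadingCoeff : ZMod p)⁻¹ * x, ?_⟩
  have h1 := hrel p ((f.leadingCoeff : ZMod p)⁻¹ * x)
  rw [mul_inv_cancel_left₀ h0, hx, zero_eq_mul] at h1
  exact h1.resolve_left (pow_ne_zero _ h0)

end RootsModPrimes

section RadicalHeight

theorem intRadical_pos (m : ℤ) : 0 < IntRadical m :=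
  Finset.prod_pos fun _ hp => (Nat.prime_of_mem_primeFactors hp).pos

theorem one_le_intRadical (m : ℤ) : (1 : ℝ) ≤ IntRadical m := by
  exact_mod_cast intRadical_pos m

theorem intRadical_le_intRadical {a b : ℤ} (hb : b ≠ 0)
    (h : ∀ p : ℕ, p.Prime → (p : ℤ) ∣ a → (p : ℤ) ∣ b) : IntRadical a ≤ IntRadical b := by
  refine Finset.prod_le_prod_of_subset_of_one_le' (fun p hp => ?_)
    fun p hp _ => (Nat.prime_of_mem_primeFactors hp).pos
  rw [Nat.mem_primeFactors, ← Int.natCast_dvd] at hp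
  rw [Nat.mem_primeFactors, ← Int.natCast_dvd]
  exact ⟨hp.1, h p hp.1 hp.2.1, Int.natAbs_ne_zero.2 hb⟩

theorem intRadical_le_natAbs {a : ℤ} (ha : a ≠ 0) : IntRadical a ≤ a.natAbs :=
  Nat.le_of_dvd (Int.natAbs_pos.2 ha) (Nat.prod_primeFactors_dvd _)

theorem intRadical_mul_le (a b : ℤ) : IntRadical (a * b) ≤ IntRadical a * IntRadical b := by
  rcases eq_or_ne a 0 with rfl | ha
  · rw [zero_mul]
    exact Nat.le_mul_of_pos_right _ (intRadical_pos b)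
  rcases eq_or_ne b 0 with rfl | hb
  · rw [mul_zero]
    exact Nat.le_mul_of_pos_left _ (intRadical_pos a)
  rw [IntRadical, Int.natAbs_mul, Nat.primeFactors_mul (Int.natAbs_ne_zero.2 ha)
    (Int.natAbs_ne_zero.2 hb), IntRadical, IntRadical, ← Finset.prod_union_inter]
  exact Nat.le_mul_of_pos_right _ (Finset.prod_pos fun p hp =>
    (Nat.prime_of_mem_primeFactors (Finset.mem_inter.1 hp).1).pos)

/-- The height of a rational number. -/
noncomputable def ratHeight (x : ℚ) : ℝ := max |(x.num : ℝ)| x.den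

theorem one_le_ratHeight (x : ℚ) : 1 ≤ ratHeight x :=
  le_max_of_le_right (by exact_mod_cast x.pos)

theorem abs_num_le_ratHeight (x : ℚ) : |(x.num : ℝ)| ≤ ratHeight x := le_max_left _ _

theorem den_le_ratHeight (x : ℚ) : (x.den : ℝ) ≤ ratHeight x := le_max_right _ _

theorem ratHeight_eq (x : ℚ) : ratHeight x = x.den * max 1 |(x : ℝ)| := by
  have h : (0 : ℝ) < x.den := by exact_mod_cast x.pos
  rw [mul_max_of_nonneg _ _ h.le, ratHeight, max_comm, mul_one]
  congr 1
  have h1 : (x.num : ℝ) = x.den * x := by exact_mod_cast (Rat.den_mul_eq_num x).symm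
  rw [h1, abs_mul, abs_of_pos h]

theorem exists_int_polynomial (g : ℚ[X]) : ∃ K : ℤ, K ≠ 0 ∧ ∃ G : ℤ[X],
    G.map (Int.castRingHom ℚ) = C (K : ℚ) * g := by
  obtain ⟨b, hb, h⟩ := IsLocalization.integerNormalization_spec (nonZeroDivisors ℤ) g
  refine ⟨b, nonZeroDivisors.ne_zero hb,
    IsLocalization.integerNormalization (nonZeroDivisors ℤ) g, ?_⟩
  rw [show Int.castRingHom ℚ = algebraMap ℤ ℚ from rfl, h, ← smul_eq_C_mul]
  ext i
  simp

/-- The value at `x.num / x.den` of the homogenization of `G`. -/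
noncomputable def homEval (G : ℤ[X]) (x : ℚ) : ℤ := (G.scaleRoots x.den).eval x.num

theorem cast_homEval (G : ℤ[X]) (x : ℚ) :
    (homEval G x : ℚ) = x.den ^ G.natDegree * (G.map (Int.castRingHom ℚ)).eval x := by
  have h := scaleRoots_eval₂_mul (p := G) (Int.castRingHom ℚ) x (x.den : ℤ)
  simp only [eq_intCast, Int.cast_natCast, Rat.den_mul_eq_num] at h
  rw [eval_map, ← h, homEval, ← eq_intCast (Int.castRingHom ℚ) (eval _ _),
    ← eval₂_hom (Int.castRingHom ℚ), eq_intCast]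

theorem homEval_eq_sum (G : ℤ[X]) (x : ℚ) : homEval G x =
    ∑ i ∈ Finset.range (G.natDegree + 1), G.coeff i * x.den ^ (G.natDegree - i) * x.num ^ i := by
  rw [homEval, eval_eq_sum_range, natDegree_scaleRoots]
  simp

theorem exists_abs_homEval_le (G : ℤ[X]) : ∃ C : ℝ, 0 < C ∧ ∀ x : ℚ,
    |(homEval G x : ℝ)| ≤ C * ratHeight x ^ G.natDegree := by
  refine ⟨∑ i ∈ Finset.range (G.natDegree + 1), |(G.coeff i : ℝ)| + 1, by positivity,
    fun x => ?_⟩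
  have h1 := one_le_ratHeight x
  have h0 : 0 ≤ ratHeight x ^ G.natDegree := by positivity
  refine le_trans ?_ (mul_le_mul_of_nonneg_right (le_add_of_nonneg_right zero_le_one) h0)
  rw [homEval_eq_sum, Int.cast_sum, Finset.sum_mul]
  refine (Finset.abs_sum_le_sum_abs _ _).trans (Finset.sum_le_sum fun i hi => ?_)
  push_cast
  rw [abs_mul, abs_mul, abs_pow, abs_pow, mul_assoc, Nat.abs_cast]
  refine mul_le_mul_of_nonneg_left ?_ (abs_nonneg _)
  have hi' : i ≤ G.natDegree := by simpa [Nat.lt_succ_iff] using hi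
  calc (x.den : ℝ) ^ (G.natDegree - i) * |(x.num : ℝ)| ^ i
      ≤ ratHeight x ^ (G.natDegree - i) * ratHeight x ^ i := by
        gcongr
        · exact den_le_ratHeight x
        · exact abs_num_le_ratHeight x
    _ = _ := by rw [← pow_add, Nat.sub_add_cancel hi']

theorem gcd_den_homEval_dvd (G : ℤ[X]) (x : ℚ) :
    GCDMonoid.gcd ((x.den : ℤ) ^ G.natDegree) (homEval G x) ∣ G.leadingCoeff ^ G.natDegree := by
  refine gcd_pow_left_dvd_pow_gcd.trans (pow_dvd_pow_of_dvd ?_ _)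
  have h1 := gcd_dvd_left (x.den : ℤ) (homEval G x)
  have h2 := gcd_dvd_right (x.den : ℤ) (homEval G x)
  have h3 : IsCoprime (GCDMonoid.gcd (x.den : ℤ) (homEval G x)) (x.num ^ G.natDegree) :=
    ((Rat.isCoprime_num_den x).symm.of_isCoprime_of_dvd_left h1).pow_right
  refine h3.dvd_of_dvd_mul_right ?_
  have h4 : homEval G x = ∑ i ∈ Finset.range G.natDegree,
      G.coeff i * x.den ^ (G.natDegree - i) * x.num ^ i +
        G.leadingCoeff * x.num ^ G.natDegree := by
    rw [homEval_eq_sum, Finset.sum_range_succ, Nat.sub_self, pow_zero, mul_one, leadingCoeff]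
  have h5 := h2.trans h4.dvd
  refine (dvd_add_right (Finset.dvd_sum fun i hi => ?_)).1 h5
  refine Dvd.dvd.mul_right (Dvd.dvd.mul_left (h1.trans (dvd_pow_self _ ?_)) _) _
  have := Finset.mem_range.1 hi
  lia

theorem exists_homEval (g : ℚ[X]) : ∃ K : ℤ, K ≠ 0 ∧ ∃ G : ℤ[X], G.natDegree = g.natDegree ∧
    ∀ x : ℚ, (homEval G x : ℚ) = K * x.den ^ g.natDegree * g.eval x := by
  obtain ⟨K, hK, G, hG⟩ := exists_int_polynomial g
  have hd : G.natDegree = g.natDegree := by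
    rw [← natDegree_map_eq_of_injective (RingHom.injective_int (Int.castRingHom ℚ)) G, hG,
      natDegree_C_mul (Int.cast_ne_zero.2 hK)]
  refine ⟨K, hK, G, hd, fun x => ?_⟩
  rw [cast_homEval, hG, hd, eval_mul, eval_C]
  ring

theorem Rat.den_dvd_of_mul_eq {q : ℚ} {m k : ℤ} (h : q * m = k) : (q.den : ℤ) ∣ m := by
  have h1 : q.num * m = k * q.den := by
    have : (q.num : ℚ) * m = k * q.den := by rw [← h, ← Rat.den_mul_eq_num q]; ring
    exact_mod_cast this
  exact (Rat.isCoprime_num_den q).symm.dvd_of_dvd_mul_left (h1 ▸ dvd_mul_left _ _)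

theorem Rat.num_dvd_of_mul_eq {q : ℚ} {m k : ℤ} (h : q * m = k) : q.num ∣ k := by
  have h1 : q.num * m = k * q.den := by
    have : (q.num : ℚ) * m = k * q.den := by rw [← h, ← Rat.den_mul_eq_num q]; ring
    exact_mod_cast this
  exact (Rat.isCoprime_num_den q).dvd_of_dvd_mul_right (h1 ▸ dvd_mul_right _ _)

theorem exists_den_eval_dvd (g : ℚ[X]) : ∃ K : ℤ, K ≠ 0 ∧ ∀ x : ℚ,
    ((g.eval x).den : ℤ) ∣ K * x.den ^ g.natDegree := by
  obtain ⟨K, hK, G, -, hG⟩ := exists_homEval g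
  refine ⟨K, hK, fun x => Rat.den_dvd_of_mul_eq (k := homEval G x) ?_⟩
  rw [hG]
  push_cast
  ring

theorem exists_den_eval_ge (g : ℚ[X]) (hg : g ≠ 0) : ∃ c : ℝ, 0 < c ∧ ∀ x : ℚ,
    c * (x.den : ℝ) ^ g.natDegree ≤ (g.eval x).den := by
  obtain ⟨K, hK, G, hd, hG⟩ := exists_homEval g
  have hG0 : G ≠ 0 := by
    rintro rfl
    have h0 : ∀ x : ℚ, g.eval x = 0 := fun x => by
      have h1 := hG x
      have h2 : (x.den : ℚ) ≠ 0 := by exact_mod_cast x.pos.ne'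
      have h3 : (K : ℚ) ≠ 0 := by exact_mod_cast hK
      simpa [homEval, h2, h3] using h1
    exact hg (Polynomial.funext fun x => by rw [h0, eval_zero])
  have hl : G.leadingCoeff ≠ 0 := leadingCoeff_ne_zero.2 hG0
  have hl' : 0 < |(G.leadingCoeff : ℝ)| ^ g.natDegree := by positivity
  refine ⟨(|(G.leadingCoeff : ℝ)| ^ g.natDegree)⁻¹, inv_pos.2 hl', fun x => ?_⟩
  rw [inv_mul_le_iff₀ hl']
  set y := g.eval x
  have h1 : K * x.den ^ g.natDegree * y.num = homEval G x * y.den := by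
    have : (K : ℚ) * x.den ^ g.natDegree * y.num = homEval G x * y.den := by
      rw [hG, ← Rat.den_mul_eq_num y]; ring
    exact_mod_cast this
  have h2 : (x.den : ℤ) ^ g.natDegree ∣ homEval G x * y.den := by
    rw [← h1, mul_assoc]
    exact Dvd.dvd.mul_left (dvd_mul_right _ _) _
  have h3 := (dvd_gcd_mul_of_dvd_mul h2).trans
    (mul_dvd_mul_right (hd ▸ gcd_den_homEval_dvd G x) _)
  have h4 := Int.le_of_dvd (by have := y.pos; positivity) ((dvd_abs _ _).2 h3)
  rw [abs_mul, abs_pow, Nat.abs_cast] at h4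
  exact_mod_cast h4

theorem exists_max_eval_ge (g : ℝ[X]) (hg : g ≠ 0) : ∃ c : ℝ, 0 < c ∧ ∀ x : ℝ,
    c * max 1 |x| ^ g.natDegree ≤ max 1 |g.eval x| := by
  rcases Nat.eq_zero_or_pos g.natDegree with hN | hN
  · exact ⟨1, one_pos, fun x => by simp [hN]⟩
  obtain ⟨N, hN⟩ : ∃ N, g.natDegree = N + 1 := ⟨g.natDegree - 1, by lia⟩
  set a := |g.leadingCoeff|
  have ha : 0 < a := abs_pos.2 (leadingCoeff_ne_zero.2 hg)
  set S := ∑ i ∈ Finset.range (N + 1), |g.coeff i| + a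
  have hS : a ≤ S := le_add_of_nonneg_left (by positivity)
  have hS0 : 0 < S := ha.trans_le hS
  have hkey : ∀ x : ℝ, a * max 1 |x| ^ (N + 1) ≤ max 1 |g.eval x| + S * max 1 |x| ^ N := by
    intro x
    have hm : 1 ≤ max 1 |x| := le_max_left _ _
    have hsum : |∑ i ∈ Finset.range (N + 1), g.coeff i * x ^ i| ≤
        (∑ i ∈ Finset.range (N + 1), |g.coeff i|) * max 1 |x| ^ N := by
      rw [Finset.sum_mul]
      refine (Finset.abs_sum_le_sum_abs _ _).trans (Finset.sum_le_sum fun i hi => ?_)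
      rw [abs_mul, abs_pow]
      have hi := Finset.mem_range.1 hi
      exact mul_le_mul_of_nonneg_left ((pow_le_pow_left₀ (abs_nonneg _) (le_max_right _ _) _).trans
        (pow_le_pow_right₀ hm (by lia))) (abs_nonneg _)
    have hev : g.eval x = ∑ i ∈ Finset.range (N + 1), g.coeff i * x ^ i +
        g.leadingCoeff * x ^ (N + 1) := by
      rw [eval_eq_sum_range, hN, Finset.sum_range_succ, leadingCoeff, hN]
    have h1 : a * |x| ^ (N + 1) ≤ |g.eval x| +
        (∑ i ∈ Finset.range (N + 1), |g.coeff i|) * max 1 |x| ^ N := by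
      rw [← abs_pow, ← abs_mul]
      have h2 : g.leadingCoeff * x ^ (N + 1) =
        g.eval x - ∑ i ∈ Finset.range (N + 1), g.coeff i * x ^ i := by rw [hev]; ring
      rw [h2]
      exact (abs_sub _ _).trans (add_le_add_right hsum _)
    have h2 : a * max 1 |x| ^ (N + 1) ≤ a * |x| ^ (N + 1) + a * max 1 |x| ^ N := by
      rcases le_total 1 |x| with h | h
      · rw [max_eq_right h]
        exact le_add_of_nonneg_right (by positivity)
      · rw [max_eq_left h, one_pow, one_pow]
        exact le_add_of_nonneg_left (by positivity)
    have h3 := le_max_right 1 |g.eval x|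
    simp only [S, add_mul]
    linarith
  refine ⟨min (a / 2) ((a / (2 * S)) ^ (N + 1)), by positivity, fun x => ?_⟩
  rw [hN]
  have hm : 1 ≤ max 1 |x| := le_max_left _ _
  have hM : 1 ≤ max 1 |g.eval x| := le_max_left _ _
  rcases le_total (2 * S) (a * max 1 |x|) with h | h
  · have h1 := hkey x
    have h2 : 2 * S * max 1 |x| ^ N ≤ a * max 1 |x| ^ (N + 1) := by
      rw [pow_succ', ← mul_assoc]
      exact mul_le_mul_of_nonneg_right h (by positivity)
    calc _ ≤ a / 2 * max 1 |x| ^ (N + 1) := by gcongr; exact min_le_left _ _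
      _ ≤ _ := by linarith
  · calc _ ≤ (a / (2 * S)) ^ (N + 1) * max 1 |x| ^ (N + 1) := by gcongr; exact min_le_right _ _
      _ = (a * max 1 |x| / (2 * S)) ^ (N + 1) := by rw [← mul_pow]; ring
      _ ≤ 1 := pow_le_one₀ (by positivity) ((div_le_one (by positivity)).2 h)
      _ ≤ _ := hM

theorem exists_ratHeight_eval_ge (g : ℚ[X]) (hg : g ≠ 0) : ∃ c : ℝ, 0 < c ∧ ∀ x : ℚ,
    c * ratHeight x ^ g.natDegree ≤ ratHeight (g.eval x) := by
  obtain ⟨c₁, hc₁, h₁⟩ := exists_den_eval_ge g hg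
  obtain ⟨c₂, hc₂, h₂⟩ := exists_max_eval_ge (g.map (algebraMap ℚ ℝ))
    ((Polynomial.map_ne_zero_iff (algebraMap ℚ ℝ).injective).2 hg)
  refine ⟨c₁ * c₂, by positivity, fun x => ?_⟩
  have h3 := h₂ x
  rw [natDegree_map, ← eq_ratCast (algebraMap ℚ ℝ), eval_map_algebraMap, aeval_algebraMap_apply,
    eq_ratCast, eq_ratCast, coe_aeval_eq_eval] at h3
  rw [ratHeight_eq, ratHeight_eq, mul_pow]
  calc _ = (c₁ * (x.den : ℝ) ^ g.natDegree) * (c₂ * max 1 |(x : ℝ)| ^ g.natDegree) := by ring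
    _ ≤ _ := mul_le_mul (h₁ x) h3 (by positivity) (by positivity)

theorem exists_abs_num_eval_le (g : ℚ[X]) : ∃ C : ℝ, 0 < C ∧ ∀ x : ℚ,
    |((g.eval x).num : ℝ)| ≤ C * ratHeight x ^ g.natDegree := by
  obtain ⟨K, hK, G, hd, hG⟩ := exists_homEval g
  obtain ⟨C, hC, h⟩ := exists_abs_homEval_le G
  refine ⟨C, hC, fun x => ?_⟩
  rcases eq_or_ne (homEval G x) 0 with h0 | h0
  · have h1 := hG x
    have h2 : (x.den : ℚ) ≠ 0 := by exact_mod_cast x.pos.ne'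
    have h3 : (K : ℚ) ≠ 0 := by exact_mod_cast hK
    have h4 : g.eval x = 0 := by simpa [h0, h2, h3] using h1
    have := one_le_ratHeight x
    rw [h4, Rat.num_zero, Int.cast_zero, abs_zero]
    positivity
  · have h1 : (g.eval x).num ∣ homEval G x :=
      Rat.num_dvd_of_mul_eq (m := K * x.den ^ g.natDegree) (by rw [hG]; push_cast; ring)
    rw [← hd]
    refine le_trans ?_ (h x)
    have := Int.le_of_dvd (abs_pos.2 h0) ((abs_dvd_abs _ _).2 h1)
    exact_mod_cast this

end RadicalHeight

section Belyi

open scoped Classical in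
/-- The distinct roots of a rational polynomial in the algebraic closure. -/
noncomputable def algRoots (h : ℚ[X]) : Finset (AlgebraicClosure ℚ) :=
  (h.aroots (AlgebraicClosure ℚ)).toFinset

theorem mem_algRoots {h : ℚ[X]} (h0 : h ≠ 0) {a : AlgebraicClosure ℚ} :
    a ∈ algRoots h ↔ aeval a h = 0 := by
  classical
  rw [algRoots, Multiset.mem_toFinset, mem_aroots]
  exact and_iff_right h0

/-- The lower bound that the `abc` conjecture yields for the radical of the values of `h`, up to
the prime factors of the denominator. -/
def AbcBound (h : ℚ[X]) : Prop :=
  ∀ ε : ℝ, 0 < ε → ∃ C : ℝ, 0 < C ∧ ∀ x : ℚ, h.eval x ≠ 0 →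
    ratHeight x ^ (((algRoots h).card : ℝ) - 1 - ε) ≤ C * IntRadical ((h.eval x).num * x.den)

theorem sum_rootMultiplicity_eq_natDegree {k : Type*} [Field k] [IsAlgClosed k] [DecidableEq k]
    (P : k[X]) (R : Finset k) (hR : P.roots.toFinset ⊆ R) :
    ∑ t ∈ R, rootMultiplicity t P = P.natDegree := by
  rw [(IsAlgClosed.splits P).natDegree_eq_card_roots, ← Multiset.toFinset_sum_count_eq]
  simp only [count_roots]
  refine (Finset.sum_subset hR fun t _ ht => ?_).symm
  rw [← count_roots, Multiset.count_eq_zero]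
  simpa using ht

/-- A Riemann–Hurwitz count: if `h` kills the critical values of `g`, the number of roots of
`h ∘ g` is as small as possible. -/
theorem card_algRoots_comp (h g : ℚ[X]) (h0 : h ≠ 0) (hg : 1 ≤ g.natDegree)
    (hcrit : ∀ c : AlgebraicClosure ℚ, aeval c (derivative g) = 0 → aeval (aeval c g) h = 0) :
    (algRoots (h.comp g)).card + (g.natDegree - 1) = g.natDegree * (algRoots h).card := by
  classical
  have hcomp : h.comp g ≠ 0 := by
    rw [Ne, comp_eq_zero_iff, not_or, not_and]
    refine ⟨h0, fun _ hC => ?_⟩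
    rw [hC, natDegree_C] at hg
    lia
  set G := g.map (algebraMap ℚ (AlgebraicClosure ℚ)) with hG
  have hGd : G.natDegree = g.natDegree := natDegree_map _
  have hGe : ∀ t, G.eval t = aeval t g := fun t => by rw [hG, eval_map_algebraMap]
  have hmem : ∀ t, t ∈ algRoots (h.comp g) ↔ G.eval t ∈ algRoots h := fun t => by
    rw [mem_algRoots hcomp, mem_algRoots h0, aeval_comp, hGe]
  have hsub : ∀ s, (G - C s).natDegree = g.natDegree := fun s => by rw [natDegree_sub_C, hGd]
  have hsub0 : ∀ s, G - C s ≠ 0 := fun s hs => by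
    have := hsub s
    rw [hs, natDegree_zero] at this
    lia
  have h1 : ∑ t ∈ algRoots (h.comp g), rootMultiplicity t (G - C (G.eval t)) =
      g.natDegree * (algRoots h).card := by
    rw [← Finset.sum_fiberwise_of_maps_to (t := algRoots h) (g := fun t => G.eval t)
      fun t ht => (hmem t).1 ht, mul_comm, ← smul_eq_mul]
    refine Finset.sum_eq_card_nsmul fun s hs => ?_
    rw [← hsub s, ← sum_rootMultiplicity_eq_natDegree (G - C s)
      ((algRoots (h.comp g)).filter fun t => G.eval t = s)]
    · exact Finset.sum_congr rfl fun t ht => by rw [(Finset.mem_filter.1 ht).2]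
    · intro t ht
      have ht' : G.eval t = s := by
        rw [Multiset.mem_toFinset, mem_roots (hsub0 s), IsRoot.def, eval_sub, eval_C] at ht
        exact sub_eq_zero.1 ht
      exact Finset.mem_filter.2 ⟨(hmem t).2 (ht' ▸ hs), ht'⟩
  have hd : (derivative G).natDegree = g.natDegree - 1 := by rw [natDegree_derivative, hGd]
  have hd0 : derivative G ≠ 0 := fun h => by
    have := derivative_eq_zero.1 h
    lia
  have h2 : ∑ t ∈ algRoots (h.comp g), rootMultiplicity t (derivative G) = g.natDegree - 1 := by
    rw [← hd]
    refine sum_rootMultiplicity_eq_natDegree _ _ fun t ht => ?_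
    rw [Multiset.mem_toFinset, mem_roots hd0, IsRoot.def, hG, derivative_map,
      eval_map_algebraMap] at ht
    rw [hmem, mem_algRoots h0, hGe]
    exact hcrit t ht
  rw [← h1, ← h2, Finset.card_eq_sum_ones, ← Finset.sum_add_distrib]
  refine Finset.sum_congr rfl fun t _ => ?_
  have hroot : (G - C (G.eval t)).IsRoot t := by simp
  have h3 := derivative_rootMultiplicity_of_root hroot
  have h4 := (rootMultiplicity_pos (hsub0 (G.eval t))).2 hroot
  rw [derivative_sub, derivative_C, sub_zero] at h3
  lia

theorem AbcBound.comp {h g : ℚ[X]} (hh : AbcBound h) (h0 : h ≠ 0) (hg : 1 ≤ g.natDegree)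
    (hcrit : ∀ c : AlgebraicClosure ℚ, aeval c (derivative g) = 0 → aeval (aeval c g) h = 0) :
    AbcBound (h.comp g) := by
  intro ε hε
  have hN : (0 : ℝ) < g.natDegree := by exact_mod_cast hg
  obtain ⟨C, hC, hCb⟩ := hh (ε / g.natDegree) (by positivity)
  have hg0 : g ≠ 0 := by rintro rfl; simp at hg
  obtain ⟨c, hc, hcb⟩ := exists_ratHeight_eval_ge g hg0
  obtain ⟨K, hK, hKb⟩ := exists_den_eval_dvd g
  set e : ℝ := ((algRoots h).card : ℝ) - 1 - ε / g.natDegree with he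
  have hcount : ((algRoots (h.comp g)).card : ℝ) - 1 - ε = g.natDegree * e := by
    have h1 : ((algRoots (h.comp g)).card : ℝ) + (g.natDegree - 1) =
        g.natDegree * (algRoots h).card := by
      have := card_algRoots_comp h g h0 hg hcrit
      rw [← Nat.cast_one, ← Nat.cast_sub hg]
      exact_mod_cast this
    rw [he, mul_sub, mul_sub, mul_div_cancel₀ _ hN.ne']
    linarith
  have hK' : (0 : ℝ) < K.natAbs := by exact_mod_cast Int.natAbs_pos.2 hK
  refine ⟨max 1 ((c ^ e)⁻¹ * C * K.natAbs), by positivity, fun x hx => ?_⟩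
  rw [hcount]
  have hH := one_le_ratHeight x
  have hrad := one_le_intRadical (((h.comp g).eval x).num * x.den)
  rcases le_total e 0 with he0 | he0
  · calc _ ≤ (1 : ℝ) := Real.rpow_le_one_of_one_le_of_nonpos hH
          (mul_nonpos_of_nonneg_of_nonpos hN.le he0)
      _ = 1 * 1 := (one_mul 1).symm
      _ ≤ _ := mul_le_mul (le_max_left _ _) hrad zero_le_one (by positivity)
  · rw [eval_comp] at hx hrad ⊢
    have hradle : (IntRadical ((h.eval (g.eval x)).num * (g.eval x).den) : ℝ) ≤
        K.natAbs * IntRadical ((h.eval (g.eval x)).num * x.den) := by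
      have hx' : (h.eval (g.eval x)).num * (x.den : ℤ) ≠ 0 :=
        mul_ne_zero (Rat.num_ne_zero.2 hx) (by exact_mod_cast x.pos.ne')
      have h1 : IntRadical ((h.eval (g.eval x)).num * (g.eval x).den) ≤
          IntRadical (K * ((h.eval (g.eval x)).num * x.den)) := by
        refine intRadical_le_intRadical (mul_ne_zero hK hx') fun p hp hdvd => ?_
        have hp' := Nat.prime_iff_prime_int.1 hp
        rcases hp'.dvd_or_dvd hdvd with h2 | h2
        · exact Dvd.dvd.mul_left (h2.mul_right _) _
        · rcases hp'.dvd_or_dvd (h2.trans (hKb x)) with h3 | h3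
          · exact h3.mul_right _
          · exact Dvd.dvd.mul_left (Dvd.dvd.mul_left (hp'.dvd_of_dvd_pow h3) _) _
      exact_mod_cast h1.trans ((intRadical_mul_le _ _).trans
        (Nat.mul_le_mul_right _ (intRadical_le_natAbs hK)))
    have h1 := hCb (g.eval x) hx
    have h2 : (c * ratHeight x ^ g.natDegree) ^ e ≤ ratHeight (g.eval x) ^ e :=
      Real.rpow_le_rpow (by positivity) (hcb x) he0
    rw [Real.mul_rpow hc.le (by positivity), ← Real.rpow_natCast, ← Real.rpow_mul (by positivity)]
      at h2
    have hce : 0 < c ^ e := by positivity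
    calc ratHeight x ^ (g.natDegree * e)
        = (c ^ e)⁻¹ * (c ^ e * ratHeight x ^ (g.natDegree * e)) := by
          rw [inv_mul_cancel_left₀ hce.ne']
      _ ≤ (c ^ e)⁻¹ * (C * (K.natAbs * IntRadical ((h.eval (g.eval x)).num * x.den))) := by
          exact mul_le_mul_of_nonneg_left
            (h2.trans (h1.trans (mul_le_mul_of_nonneg_left hradle hC.le))) (inv_nonneg.2 hce.le)
      _ = (c ^ e)⁻¹ * C * K.natAbs * IntRadical ((h.eval (g.eval x)).num * x.den) := by ring
      _ ≤ _ := by gcongr; exact le_max_right _ _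

theorem Rat.prime_dvd_num_mul {p : ℕ} (hp : p.Prime) {a b : ℚ} (h : (p : ℤ) ∣ a.num) :
    (p : ℤ) ∣ (a * b).num ∨ (p : ℤ) ∣ b.den := by
  have hp' := Nat.prime_iff_prime_int.1 hp
  have h1 : (p : ℤ) ∣ (a * b).num * a.den * b.den := by
    rw [Rat.mul_num_den']
    exact (h.mul_right _).mul_right _
  rcases hp'.dvd_or_dvd h1 with h2 | h2
  · rcases hp'.dvd_or_dvd h2 with h3 | h3
    · exact Or.inl h3
    · exact absurd ((Rat.isCoprime_num_den a).isUnit_of_dvd' h h3) hp'.not_isUnit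
  · exact Or.inr h2

theorem Rat.num_mul_dvd (a b : ℚ) : (a * b).num ∣ a.num * b.num :=
  Rat.num_dvd_of_mul_eq (m := a.den * b.den) (by
    push_cast
    rw [← Rat.den_mul_eq_num a, ← Rat.den_mul_eq_num b]
    ring)

theorem dvd_of_squarefree_of_roots {f h : ℚ[X]} (h0 : h ≠ 0) (hf : Squarefree f)
    (hr : ∀ a : AlgebraicClosure ℚ, aeval a f = 0 → aeval a h = 0) : f ∣ h := by
  have hf0 := hf.ne_zero
  rw [← map_dvd_map' (algebraMap ℚ (AlgebraicClosure ℚ))]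
  refine (IsAlgClosed.splits _).dvd_of_roots_le_roots (map_ne_zero hf0) ?_
  rw [Multiset.le_iff_subset (nodup_roots
    (PerfectField.separable_iff_squarefree.2 hf).map)]
  intro a ha
  rw [mem_roots (map_ne_zero hf0), IsRoot.def, eval_map_algebraMap] at ha
  rw [mem_roots (map_ne_zero h0), IsRoot.def, eval_map_algebraMap]
  exact hr a ha

theorem AbcBound.of_squarefree {h f : ℚ[X]} (hh : AbcBound h) (h0 : h ≠ 0) (hf : Squarefree f)
    (hr : ∀ a : AlgebraicClosure ℚ, aeval a f = 0 → aeval a h = 0) :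
    ∀ ε : ℝ, 0 < ε → ∃ C : ℝ, 0 < C ∧ ∀ x : ℚ, f.eval x ≠ 0 →
      ratHeight x ^ ((f.natDegree : ℝ) - 1 - ε) ≤ C * IntRadical ((f.eval x).num * x.den) := by
  classical
  intro ε hε
  set r := UniqueFactorizationMonoid.radical h with hrdef
  have hrsq : Squarefree r := UniqueFactorizationMonoid.squarefree_radical
  have hr0 : r ≠ 0 := hrsq.ne_zero
  obtain ⟨k, hk⟩ : f ∣ r := (UniqueFactorizationMonoid.dvd_radical_iff hf.isRadical h0).2
    (dvd_of_squarefree_of_roots h0 hf hr)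
  have hf0 : f ≠ 0 := hf.ne_zero
  have hk0 : k ≠ 0 := by rintro rfl; exact hr0 (by rw [hk, mul_zero])
  obtain ⟨M, w, hw⟩ := UniqueFactorizationMonoid.exists_dvd_radical_self_pow h0
  rw [← hrdef] at hw
  have hcard : (algRoots h).card = f.natDegree + k.natDegree := by
    rw [← natDegree_mul hf0 hk0, ← hk,
      ← card_rootSet_eq_natDegree (K := AlgebraicClosure ℚ)
        (PerfectField.separable_iff_squarefree.2 hrsq) (IsAlgClosed.splits _),
      ← Set.toFinset_card]
    congr 1
    ext a
    rw [mem_algRoots h0, Set.mem_toFinset, mem_rootSet_of_ne hr0]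
    constructor
    · intro ha
      have h1 := congrArg (aeval a) hw
      rw [map_pow, map_mul, ha, zero_mul] at h1
      exact eq_zero_of_pow_eq_zero h1
    · intro ha
      obtain ⟨q, hq⟩ := UniqueFactorizationMonoid.radical_dvd_self (a := h)
      rw [← hrdef] at hq
      rw [hq, map_mul, ha, zero_mul]
  obtain ⟨C, hC, hCb⟩ := hh ε hε
  obtain ⟨K, hK, hKb⟩ := exists_den_eval_dvd w
  obtain ⟨B, hB, hBb⟩ := exists_abs_num_eval_le k
  have hfin : {x : ℚ | k.eval x = 0}.Finite := by
    refine (Multiset.finite_toSet k.roots).subset fun x hx => ?_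
    exact (mem_roots hk0).2 hx
  obtain ⟨C₂, hC₂⟩ := (hfin.image fun x => ratHeight x ^ ((f.natDegree : ℝ) - 1 - ε)).bddAbove
  refine ⟨max C₂ (C * (K.natAbs * B)), lt_max_of_lt_right (by positivity), fun x hx => ?_⟩
  have hH := one_le_ratHeight x
  have hrad := one_le_intRadical ((f.eval x).num * x.den)
  by_cases hkx : k.eval x = 0
  · have h1 : ratHeight x ^ ((f.natDegree : ℝ) - 1 - ε) ≤ C₂ := hC₂ (Set.mem_image_of_mem _ hkx)
    have h2 : 0 < ratHeight x ^ ((f.natDegree : ℝ) - 1 - ε) := by positivity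
    calc _ ≤ C₂ := h1
      _ ≤ C₂ * IntRadical ((f.eval x).num * x.den) := le_mul_of_one_le_right (h2.le.trans h1) hrad
      _ ≤ _ := by gcongr; exact le_max_left _ _
  have hwx : h.eval x * w.eval x = (f.eval x * k.eval x) ^ M := by
    rw [← eval_mul, ← hw, hk, eval_pow, eval_mul]
  have hhx : h.eval x ≠ 0 := by
    intro h1
    rw [h1, zero_mul] at hwx
    exact pow_ne_zero M (mul_ne_zero hx hkx) hwx.symm
  have hxd : (x.den : ℤ) ≠ 0 := by exact_mod_cast x.pos.ne'
  have hn1 : (k.eval x).num ≠ 0 := Rat.num_ne_zero.2 hkx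
  have hn2 : (f.eval x).num ≠ 0 := Rat.num_ne_zero.2 hx
  have h1 : IntRadical ((h.eval x).num * x.den) ≤
      IntRadical (K * (k.eval x).num * ((f.eval x).num * x.den)) := by
    refine intRadical_le_intRadical (by positivity) fun p hp hdvd => ?_
    have hp' := Nat.prime_iff_prime_int.1 hp
    rcases hp'.dvd_or_dvd hdvd with h2 | h2
    · rcases Rat.prime_dvd_num_mul hp (b := w.eval x) h2 with h3 | h3
      · rw [hwx, Rat.num_pow] at h3
        rcases hp'.dvd_or_dvd ((hp'.dvd_of_dvd_pow h3).trans (Rat.num_mul_dvd _ _)) with h4 | h4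
        · exact Dvd.dvd.mul_left (h4.mul_right _) _
        · exact (Dvd.dvd.mul_left h4 _).mul_right _
      · rcases hp'.dvd_or_dvd (h3.trans (hKb x)) with h4 | h4
        · exact (h4.mul_right _).mul_right _
        · exact Dvd.dvd.mul_left (Dvd.dvd.mul_left (hp'.dvd_of_dvd_pow h4) _) _
    · exact Dvd.dvd.mul_left (Dvd.dvd.mul_left h2 _) _
  have h2 : (IntRadical ((h.eval x).num * x.den) : ℝ) ≤
      K.natAbs * (B * ratHeight x ^ k.natDegree) * IntRadical ((f.eval x).num * x.den) := by
    have h3 : IntRadical ((h.eval x).num * x.den) ≤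
        K.natAbs * (k.eval x).num.natAbs * IntRadical ((f.eval x).num * x.den) :=
      h1.trans ((intRadical_mul_le _ _).trans (Nat.mul_le_mul_right _
        ((intRadical_le_natAbs (mul_ne_zero hK hn1)).trans (Int.natAbs_mul _ _).le)))
    have h4 := hBb x
    rw [← Int.cast_abs, ← Int.natCast_natAbs, Int.cast_natCast] at h4
    calc (IntRadical ((h.eval x).num * x.den) : ℝ) ≤
        K.natAbs * (k.eval x).num.natAbs * IntRadical ((f.eval x).num * x.den) := by
          exact_mod_cast h3
      _ ≤ _ := by gcongr
  have h3 := hCb x hhx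
  rw [hcard, Nat.cast_add, show (f.natDegree : ℝ) + k.natDegree - 1 - ε =
    (f.natDegree - 1 - ε) + k.natDegree by ring, Real.rpow_add (by positivity),
    Real.rpow_natCast] at h3
  have h4 : 0 < ratHeight x ^ k.natDegree := by positivity
  refine le_of_mul_le_mul_right ?_ h4
  calc _ ≤ C * (K.natAbs * (B * ratHeight x ^ k.natDegree) *
          IntRadical ((f.eval x).num * x.den)) := h3.trans (mul_le_mul_of_nonneg_left h2 hC.le)
    _ = C * (K.natAbs * B) * IntRadical ((f.eval x).num * x.den) * ratHeight x ^ k.natDegree := by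
        ring
    _ ≤ _ := by gcongr; exact le_max_right _ _

theorem card_algRoots_X_mul : (algRoots (X * (X - 1))).card = 2 := by
  classical
  have h0 : (X * (X - 1) : ℚ[X]) ≠ 0 := mul_ne_zero X_ne_zero (X_sub_C_ne_zero 1)
  have : algRoots (X * (X - 1)) = {0, 1} := by
    ext a
    rw [mem_algRoots h0, Finset.mem_insert, Finset.mem_singleton]
    simp [sub_eq_zero]
  rw [this, Finset.card_pair zero_ne_one]

theorem ABCConjecture.abcBound (habc : ABCConjecture) : AbcBound (X * (X - 1)) := by
  intro ε hε
  obtain ⟨K, hK, hKb⟩ := habc ε hε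
  refine ⟨K ^ (1 + ε)⁻¹, by positivity, fun x hx => ?_⟩
  rw [card_algRoots_X_mul, Nat.cast_two]
  rw [eval_mul, eval_X, eval_sub, eval_X, eval_one] at hx ⊢
  have hx0 : x ≠ 0 := left_ne_zero_of_mul hx
  have hx1 : x - 1 ≠ 0 := right_ne_zero_of_mul hx
  have hu : x.num ≠ 0 := Rat.num_ne_zero.2 hx0
  have hv : (x.den : ℤ) ≠ 0 := by exact_mod_cast x.pos.ne'
  have hco := Rat.isCoprime_num_den x
  have hw : (x.den : ℤ) - x.num ≠ 0 := by
    intro h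
    refine hx1 (sub_eq_zero.2 ?_)
    rw [← Rat.num_div_den x, ← sub_eq_zero.1 h]
    exact div_self (by exact_mod_cast hv)
  have hb1 : IsCoprime x.num ((x.den : ℤ) - x.num) := by
    rw [sub_eq_add_neg, ← mul_neg_one, IsCoprime.add_mul_left_right_iff]
    exact hco
  have hb2 : IsCoprime ((x.den : ℤ) - x.num) x.den := by
    rw [← IsCoprime.neg_left_iff, neg_sub, sub_eq_add_neg, ← mul_neg_one,
      IsCoprime.add_mul_left_left_iff]
    exact hco
  have h1 := hKb x.num (x.den - x.num) x.den hu hw hv hb1 hco hb2 (by ring)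
  have h2 : IntRadical (x.num * (x.den - x.num) * x.den) ≤
      IntRadical ((x * (x - 1)).num * x.den) := by
    refine intRadical_le_intRadical (mul_ne_zero (Rat.num_ne_zero.2 hx) hv) fun p hp hdvd => ?_
    have hp' := Nat.prime_iff_prime_int.1 hp
    rcases hp'.dvd_or_dvd hdvd with h2 | h2
    · have h3 : (x.num * (x.den - x.num) : ℤ) * (x * (x - 1)).den =
          -(x * (x - 1)).num * (x.den * x.den) := by
        have h4 : (x.num * (x.den - x.num) : ℚ) = -(x * (x - 1)) * (x.den * x.den) := by
          nth_rw 1 2 [← Rat.den_mul_eq_num x]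
          ring
        have h5 : (x.num * (x.den - x.num) : ℚ) * (x * (x - 1)).den =
            -(x * (x - 1)).num * (x.den * x.den) := by
          rw [h4, ← Rat.den_mul_eq_num (x * (x - 1))]
          ring
        exact_mod_cast h5
      have h4 : (p : ℤ) ∣ -(x * (x - 1)).num * (x.den * x.den) := h3 ▸ h2.mul_right _
      rcases hp'.dvd_or_dvd h4 with h5 | h5
      · exact (Int.dvd_neg.1 h5).mul_right _
      · exact Dvd.dvd.mul_left ((hp'.dvd_or_dvd h5).elim id id) _
    · exact Dvd.dvd.mul_left h2 _
  have hH := one_le_ratHeight x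
  set R : ℝ := (IntRadical ((x * (x - 1)).num * x.den) : ℝ)
  have h3 : ratHeight x ≤ K * R ^ (1 + ε) := by
    calc ratHeight x ≤ ((max (max |x.num| |(x.den : ℤ) - x.num|) |(x.den : ℤ)| : ℤ) : ℝ) := by
          push_cast
          refine max_le (le_max_of_le_left (le_max_left _ _)) (le_max_of_le_right ?_)
          rw [Nat.abs_cast]
      _ ≤ _ := h1
      _ ≤ _ := by
          have h3 : (IntRadical (x.num * (x.den - x.num) * x.den) : ℝ) ≤ R := by
            exact Nat.cast_le.2 h2
          gcongr
  calc ratHeight x ^ ((2 : ℝ) - 1 - ε) ≤ ratHeight x ^ (1 + ε)⁻¹ := by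
        refine Real.rpow_le_rpow_of_exponent_le hH ?_
        rw [inv_eq_one_div, le_div_iff₀ (by positivity)]
        nlinarith
    _ ≤ (K * R ^ (1 + ε)) ^ (1 + ε)⁻¹ := Real.rpow_le_rpow (by positivity) h3 (by positivity)
    _ = K ^ (1 + ε)⁻¹ * R := by
        rw [Real.mul_rpow hK.le (by positivity), Real.rpow_rpow_inv (by positivity)
          (by positivity)]

/-- Some polynomial satisfying `AbcBound` vanishes on `A`. -/
def AbcSet (A : Finset (AlgebraicClosure ℚ)) : Prop :=
  ∃ h : ℚ[X], h ≠ 0 ∧ (∀ a ∈ A, aeval a h = 0) ∧ AbcBound h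

theorem AbcSet.mono {A B : Finset (AlgebraicClosure ℚ)} (hB : AbcSet B) (h : A ⊆ B) :
    AbcSet A := by
  obtain ⟨p, hp, hz, hb⟩ := hB
  exact ⟨p, hp, fun a ha => hz a (h ha), hb⟩

theorem AbcSet.of_image {A B : Finset (AlgebraicClosure ℚ)} (hB : AbcSet B) (g : ℚ[X])
    (hg : 1 ≤ g.natDegree) (hA : ∀ a ∈ A, aeval a g ∈ B)
    (hcrit : ∀ c : AlgebraicClosure ℚ, aeval c (derivative g) = 0 → aeval c g ∈ B) :
    AbcSet A := by
  obtain ⟨p, hp, hz, hb⟩ := hB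
  refine ⟨p.comp g, ?_, fun a ha => ?_, hb.comp hp hg fun c hc => hz _ (hcrit c hc)⟩
  · rw [Ne, comp_eq_zero_iff, not_or, not_and]
    refine ⟨hp, fun _ hC => ?_⟩
    rw [hC, natDegree_C] at hg
    lia
  · rw [aeval_comp]
    exact hz _ (hA a ha)

theorem ABCConjecture.abcSet_pair (habc : ABCConjecture) [DecidableEq (AlgebraicClosure ℚ)]
    {s t : ℚ} (hst : s ≠ t) :
    AbcSet {algebraMap ℚ (AlgebraicClosure ℚ) s, algebraMap ℚ (AlgebraicClosure ℚ) t} := by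
  have hB : AbcSet {0, 1} := by
    refine ⟨X * (X - 1), mul_ne_zero X_ne_zero (X_sub_C_ne_zero 1), ?_, habc.abcBound⟩
    simp
  have hts : (t - s)⁻¹ ≠ 0 := inv_ne_zero (sub_ne_zero.2 hst.symm)
  refine hB.of_image (C (t - s)⁻¹ * (X - C s)) ?_ ?_ ?_
  · rw [natDegree_C_mul hts, natDegree_X_sub_C]
  · have h2 : algebraMap ℚ (AlgebraicClosure ℚ) t - algebraMap ℚ (AlgebraicClosure ℚ) s ≠ 0 :=
      sub_ne_zero.2 fun h => hst ((algebraMap ℚ (AlgebraicClosure ℚ)).injective h).symm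
    intro a ha
    rw [Finset.mem_insert, Finset.mem_singleton] at ha
    rw [map_mul, map_sub, aeval_X, aeval_C, aeval_C, map_inv₀, map_sub]
    rcases ha with rfl | rfl
    · rw [sub_self, mul_zero]
      exact Finset.mem_insert_self _ _
    · rw [inv_mul_cancel₀ h2]
      exact Finset.mem_insert_of_mem (Finset.mem_singleton_self _)
  · intro c hc
    rw [derivative_C_mul, derivative_X_sub_C, mul_one, aeval_C] at hc
    exact absurd ((map_eq_zero _).1 hc) hts

theorem ABCConjecture.abcSet_image (habc : ABCConjecture) [DecidableEq (AlgebraicClosure ℚ)]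
    (S : Finset ℚ) : AbcSet (S.image (algebraMap ℚ (AlgebraicClosure ℚ))) := by
  induction hn : S.card using Nat.strong_induction_on generalizing S with
  | _ n ih =>
  subst hn
  rcases le_or_gt S.card 2 with hS | hS
  · obtain ⟨s, t, hst, hsub⟩ : ∃ s t : ℚ, s ≠ t ∧ S ⊆ {s, t} := by
      obtain ⟨T, hST, hT⟩ := Infinite.exists_superset_card_eq S 2 hS
      obtain ⟨s, t, hst, rfl⟩ := Finset.card_eq_two.1 hT
      exact ⟨s, t, hst, hST⟩
    refine (habc.abcSet_pair hst).mono ?_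
    rw [← Finset.image_singleton, ← Finset.image_insert]
    exact Finset.image_subset_image hsub
  · have hne : S.Nonempty := Finset.card_pos.1 (by lia)
    set s₁ := S.min' hne
    set s₃ := S.max' hne
    obtain ⟨s₂, hs₂, h₂₁, h₂₃⟩ : ∃ s₂ ∈ S, s₂ ≠ s₁ ∧ s₂ ≠ s₃ := by
      obtain ⟨s₂, h⟩ : (S \ {s₁, s₃}).Nonempty := by
        rw [← Finset.card_pos]
        have := Finset.le_card_sdiff {s₁, s₃} S
        have := Finset.card_le_two (a := s₁) (b := s₃)
        lia
      simp only [Finset.mem_sdiff, Finset.mem_insert, Finset.mem_singleton, not_or] at h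
      exact ⟨s₂, h.1, h.2⟩
    have hs₁ : s₁ ∈ S := S.min'_mem hne
    have hs₃ : s₃ ∈ S := S.max'_mem hne
    have h12 : s₁ < s₂ := lt_of_le_of_ne (S.min'_le _ hs₂) h₂₁.symm
    have h23 : s₂ < s₃ := lt_of_le_of_ne (S.le_max' _ hs₂) h₂₃
    obtain ⟨a, b, ha, hb, hab⟩ : ∃ a b : ℕ, 0 < a ∧ 0 < b ∧
        (a : ℚ) * (s₃ - s₂) = b * (s₂ - s₁) := by
      have hq : 0 < (s₂ - s₁) / (s₃ - s₂) := div_pos (by linarith) (by linarith)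
      have hq' := Rat.num_pos.2 hq
      refine ⟨((s₂ - s₁) / (s₃ - s₂)).num.natAbs, ((s₂ - s₁) / (s₃ - s₂)).den,
        Int.natAbs_pos.2 hq'.ne', Rat.pos _, ?_⟩
      have h3 : (((s₂ - s₁) / (s₃ - s₂)).num.natAbs : ℚ) = ((s₂ - s₁) / (s₃ - s₂)).num := by
        rw [← Int.cast_natCast, Int.natAbs_of_nonneg hq'.le]
      rw [h3, ← Rat.den_mul_eq_num, mul_assoc, div_mul_cancel₀ _ (by linarith)]
    set g : ℚ[X] := (X - C s₁) ^ a * (X - C s₃) ^ b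
    have hgd : g.natDegree = a + b := by
      rw [natDegree_mul (pow_ne_zero _ (X_sub_C_ne_zero _)) (pow_ne_zero _ (X_sub_C_ne_zero _)),
        natDegree_pow, natDegree_pow, natDegree_X_sub_C, natDegree_X_sub_C, mul_one, mul_one]
    have hg1 : g.eval s₁ = 0 := by simp [g, ha.ne']
    have hg3 : g.eval s₃ = 0 := by simp [g, hb.ne']
    have hcard : (S.image fun s => g.eval s).card < S.card := by
      refine lt_of_le_of_ne Finset.card_image_le fun h => ?_
      have := Finset.card_image_iff.1 h hs₁ hs₃ (hg1.trans hg3.symm)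
      linarith
    have hmem : ∀ s ∈ S, aeval (algebraMap ℚ (AlgebraicClosure ℚ) s) g ∈
        (S.image fun s => g.eval s).image (algebraMap ℚ (AlgebraicClosure ℚ)) := by
      intro s hs
      rw [aeval_algebraMap_apply, coe_aeval_eq_eval]
      exact Finset.mem_image_of_mem _ (Finset.mem_image_of_mem _ hs)
    refine (ih _ hcard _ rfl).of_image g (by lia) ?_ ?_
    · intro a ha
      obtain ⟨s, hs, rfl⟩ := Finset.mem_image.1 ha
      exact hmem s hs
    · intro c hc
      have hder : derivative g * ((X - C s₁) * (X - C s₃)) =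
          g * (C ((a : ℚ) + b) * (X - C s₂)) := by
        have hlin : C (a : ℚ) * (X - C s₃) + C (b : ℚ) * (X - C s₁) =
            C ((a : ℚ) + b) * (X - C s₂) := by
          have h := congrArg (C : ℚ → ℚ[X]) hab
          simp only [map_mul, map_sub, map_add] at h ⊢
          linear_combination -h
        obtain ⟨a', rfl⟩ := Nat.exists_eq_succ_of_ne_zero ha.ne'
        obtain ⟨b', rfl⟩ := Nat.exists_eq_succ_of_ne_zero hb.ne'
        rw [← hlin]
        simp only [g, derivative_mul, derivative_X_sub_C_pow, Nat.succ_sub_one,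
          Nat.succ_eq_add_one]
        ring
      have h1 := congrArg (aeval c) hder
      simp only [map_mul, hc, zero_mul, map_sub, aeval_X, aeval_C] at h1
      have h3 : algebraMap ℚ (AlgebraicClosure ℚ) (a + b) ≠ 0 :=
        (_root_.map_ne_zero _).2 (by positivity)
      rcases mul_eq_zero.1 h1.symm with h2 | h2
      · have h4 : c = algebraMap ℚ (AlgebraicClosure ℚ) s₁ ∨
            c = algebraMap ℚ (AlgebraicClosure ℚ) s₃ := by
          simp only [g, map_mul, map_pow, map_sub, aeval_X, aeval_C, mul_eq_zero,
            pow_eq_zero_iff ha.ne', pow_eq_zero_iff hb.ne', sub_eq_zero] at h2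
          exact h2
        rcases h4 with rfl | rfl
        · exact hmem _ hs₁
        · exact hmem _ hs₃
      · rw [sub_eq_zero.1 ((mul_eq_zero.1 h2).resolve_left h3)]
        exact hmem _ hs₂

theorem isIntegral_algebraicClosure_rat (a : AlgebraicClosure ℚ) : IsIntegral ℚ a := by
  obtain ⟨p, hp, h⟩ := (AlgebraicClosure.isAlgebraic ℚ).isIntegral.isIntegral a
  refine ⟨p, hp, ?_⟩
  convert h using 2
  exact Subsingleton.elim _ _

theorem natDegree_minpoly_aeval_le (a : AlgebraicClosure ℚ) (g : ℚ[X]) :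
    (minpoly ℚ (aeval a g)).natDegree ≤ (minpoly ℚ a).natDegree := by
  have h_int : ∀ b : AlgebraicClosure ℚ, IsIntegral ℚ b := isIntegral_algebraicClosure_rat
  rw [← IntermediateField.adjoin.finrank (h_int a), ← IntermediateField.adjoin.finrank (h_int _)]
  have : FiniteDimensional ℚ (IntermediateField.adjoin ℚ {a}) :=
    IntermediateField.adjoin.finiteDimensional (h_int a)
  refine LinearMap.finrank_le_finrank_of_injective
    (f := (IntermediateField.inclusion ?_).toLinearMap)
    (IntermediateField.inclusion_injective ?_)
  all_goals
    rw [IntermediateField.adjoin_simple_le_iff]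
    exact IntermediateField.algebra_adjoin_le_adjoin ℚ {a} (aeval_mem_adjoin_singleton ℚ a)

/-- Belyi's argument: every finite set of algebraic numbers lies in the zero set of a polynomial
satisfying `AbcBound`. -/
theorem ABCConjecture.abcSet_of_natDegree_le (habc : ABCConjecture) (m : ℕ)
    (A : Finset (AlgebraicClosure ℚ)) (hA : ∀ a ∈ A, (minpoly ℚ a).natDegree ≤ m + 1) :
    AbcSet A := by
  classical
  induction m generalizing A with
  | zero =>
    have h1 : ∀ a ∈ A, ∃ s : ℚ, algebraMap ℚ (AlgebraicClosure ℚ) s = a := by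
      intro a ha
      have hpos := minpoly.natDegree_pos (isIntegral_algebraicClosure_rat a)
      exact minpoly.natDegree_eq_one_iff.1 (le_antisymm (hA a ha) hpos)
    choose! s hs using h1
    refine (habc.abcSet_image (A.image s)).mono fun a ha => ?_
    rw [← hs a ha]
    exact Finset.mem_image_of_mem _ (Finset.mem_image_of_mem _ ha)
  | succ m ihm =>
    induction hk : (A.filter fun a => (minpoly ℚ a).natDegree = m + 2).card using
      Nat.strong_induction_on generalizing A with
    | _ k ihk =>
    subst hk
    rcases (A.filter fun a => (minpoly ℚ a).natDegree = m + 2).eq_empty_or_nonempty with h | h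
    · refine ihm A fun a ha => Nat.le_of_lt_succ (lt_of_le_of_ne (hA a ha) fun h1 => ?_)
      exact Finset.notMem_empty a (h ▸ Finset.mem_filter.2 ⟨ha, h1⟩)
    obtain ⟨α, hα⟩ := h
    obtain ⟨hαA, hαd⟩ := Finset.mem_filter.1 hα
    set g := minpoly ℚ α
    have hd : (derivative g).natDegree = m + 1 := by rw [natDegree_derivative, hαd]; rfl
    have hd0 : derivative g ≠ 0 := fun h0 => by rw [h0, natDegree_zero] at hd; lia
    have hcd : ∀ c ∈ algRoots (derivative g), (minpoly ℚ (aeval c g)).natDegree ≤ m + 1 := by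
      intro c hc
      refine (natDegree_minpoly_aeval_le c g).trans (hd ▸ ?_)
      exact natDegree_le_natDegree (minpoly.degree_le_of_ne_zero ℚ c hd0
        ((mem_algRoots hd0).1 hc))
    refine (ihk _ ?_ (A.image (fun a => aeval a g) ∪
      (algRoots (derivative g)).image fun c => aeval c g) ?_ rfl).of_image g (by lia) ?_ ?_
    · refine lt_of_le_of_lt ?_ (Finset.card_erase_lt_of_mem hα)
      refine (Finset.card_le_card fun b hb => ?_).trans
        (Finset.card_image_le (f := fun a => aeval a g))
      obtain ⟨hb, hbd⟩ := Finset.mem_filter.1 hb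
      rcases Finset.mem_union.1 hb with hb | hb
      · obtain ⟨a, ha, rfl⟩ := Finset.mem_image.1 hb
        refine Finset.mem_image_of_mem _ (Finset.mem_erase.2 ⟨?_, Finset.mem_filter.2 ⟨ha, ?_⟩⟩)
        · rintro rfl
          rw [minpoly.aeval, minpoly.zero, natDegree_X] at hbd
          lia
        · exact le_antisymm (hA a ha) (hbd ▸ natDegree_minpoly_aeval_le a g)
      · obtain ⟨c, hc, rfl⟩ := Finset.mem_image.1 hb
        have := hcd c hc
        lia
    · intro b hb
      rcases Finset.mem_union.1 hb with hb | hb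
      · obtain ⟨a, ha, rfl⟩ := Finset.mem_image.1 hb
        exact (natDegree_minpoly_aeval_le a g).trans (hA a ha)
      · obtain ⟨c, hc, rfl⟩ := Finset.mem_image.1 hb
        exact (hcd c hc).trans (Nat.le_succ _)
    · exact fun a ha => Finset.mem_union_left _ (Finset.mem_image_of_mem _ ha)
    · exact fun c hc => Finset.mem_union_right _
        (Finset.mem_image_of_mem _ ((mem_algRoots hd0).2 hc))

/-- Under the `abc` conjecture, values of squarefree polynomials have large radicals. -/
theorem ABCConjecture.ratHeight_rpow_le (habc : ABCConjecture) {f : ℚ[X]} (hf : Squarefree f)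
    {ε : ℝ} (hε : 0 < ε) : ∃ C : ℝ, 0 < C ∧ ∀ x : ℚ, f.eval x ≠ 0 →
      ratHeight x ^ ((f.natDegree : ℝ) - 2 - ε) ≤ C * IntRadical (f.eval x).num := by
  obtain ⟨h, h0, hz, hb⟩ := habc.abcSet_of_natDegree_le _ (algRoots f) fun a ha =>
    (Finset.le_sup (f := fun a => (minpoly ℚ a).natDegree) ha).trans (Nat.le_succ _)
  obtain ⟨C, hC, hCb⟩ := hb.of_squarefree h0 hf
    (fun a ha => hz a ((mem_algRoots hf.ne_zero).2 ha)) ε hε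
  refine ⟨C, hC, fun x hx => ?_⟩
  have hH := one_le_ratHeight x
  have h1 : (IntRadical ((f.eval x).num * x.den) : ℝ) ≤
      IntRadical (f.eval x).num * ratHeight x := by
    have h2 := (intRadical_mul_le (f.eval x).num x.den).trans (Nat.mul_le_mul_left _
      (intRadical_le_natAbs (a := x.den) (by exact_mod_cast x.pos.ne')))
    rw [Int.natAbs_natCast] at h2
    calc (IntRadical ((f.eval x).num * x.den) : ℝ) ≤ IntRadical (f.eval x).num * x.den := by
          exact_mod_cast h2
      _ ≤ _ := by gcongr; exact den_le_ratHeight x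
  have h3 := (hCb x hx).trans (mul_le_mul_of_nonneg_left h1 hC.le)
  refine le_of_mul_le_mul_right ?_ (zero_lt_one.trans_le hH)
  calc _ = ratHeight x ^ ((f.natDegree : ℝ) - 1 - ε) := by
        rw [← Real.rpow_add_one (by positivity)]
        congr 1
        ring
    _ ≤ _ := h3
    _ = _ := by ring

end Belyi

section RationalPoints

theorem NthPowerFree.natAbs_eq_one_of_pow_dvd {n : ℕ} {d q : ℤ} (hd : NthPowerFree n d)
    (h : q ^ n ∣ d) : q.natAbs = 1 := by
  by_contra h1
  obtain ⟨p, hp, hpq⟩ := Nat.exists_prime_and_dvd h1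
  exact hd.2 p hp ((pow_dvd_pow_of_dvd (Int.natCast_dvd.2 hpq) n).trans h)

/-- An `n`-th power free integer is determined, up to sign, by its class modulo `n`-th powers. -/
theorem NthPowerFree.eq_of_mul_pow_eq {n : ℕ} {d e : ℤ} (hd : NthPowerFree n d)
    (he : NthPowerFree n e) (hpos : 0 < d * e) {y z : ℚ} (hz : z ≠ 0)
    (h : (d : ℚ) * y ^ n = e * z ^ n) : d = e := by
  set r : ℚ := y / z
  have h1 : d * r.num ^ n = e * (r.den : ℤ) ^ n := by
    have hden : (r.den : ℚ) ≠ 0 := by exact_mod_cast r.pos.ne'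
    have h2 : (d : ℚ) * r ^ n = e := by
      rw [div_pow, ← mul_div_assoc, h, mul_div_cancel_right₀ _ (pow_ne_zero n hz)]
    have h3 : (d : ℚ) * r.num ^ n = e * (r.den : ℚ) ^ n := by
      rw [← Rat.den_mul_eq_num r, mul_pow, ← h2]
      ring
    exact_mod_cast h3
  have hco : IsCoprime (r.num ^ n) ((r.den : ℤ) ^ n) := (Rat.isCoprime_num_den r).pow
  have h2 : r.num.natAbs = 1 := he.natAbs_eq_one_of_pow_dvd
    (hco.dvd_of_dvd_mul_right (h1 ▸ dvd_mul_left _ _))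
  have h3 : (r.den : ℤ).natAbs = 1 := hd.natAbs_eq_one_of_pow_dvd
    (hco.symm.dvd_of_dvd_mul_right (h1 ▸ dvd_mul_left _ _))
  have h4 : d.natAbs = e.natAbs := by
    have := congrArg Int.natAbs h1
    rwa [Int.natAbs_mul, Int.natAbs_mul, Int.natAbs_pow, Int.natAbs_pow, h2, h3, one_pow,
      mul_one, mul_one] at this
  rcases Int.natAbs_eq_natAbs_iff.1 h4 with h5 | h5
  · exact h5
  · rw [h5] at hpos
    nlinarith [sq_nonneg e]

theorem exists_num_eq_of_mul_pow_eq {n : ℕ} {d : ℤ} {y q : ℚ} (hy : y ≠ 0)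
    (h : (d : ℚ) * y ^ n = q) : ∃ d₁ : ℤ, d₁ ∣ d ∧ q.num = y.num ^ n * d₁ := by
  have hden : (y.den : ℤ) ^ n ≠ 0 := pow_ne_zero _ (by exact_mod_cast y.pos.ne')
  have hnum : y.num ^ n ≠ 0 := pow_ne_zero _ (Rat.num_ne_zero.2 hy)
  have h1 : q.num * (y.den : ℤ) ^ n = y.num ^ n * (d * q.den) := by
    have h2 : (q.num : ℚ) * (y.den : ℚ) ^ n = y.num ^ n * (d * q.den) := by
      rw [← Rat.den_mul_eq_num q, ← Rat.den_mul_eq_num y, ← h]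
      ring
    exact_mod_cast h2
  have hco : IsCoprime (y.num ^ n) ((y.den : ℤ) ^ n) := (Rat.isCoprime_num_den y).pow
  obtain ⟨d₁, hd₁⟩ := hco.dvd_of_dvd_mul_right (Dvd.intro _ h1.symm)
  refine ⟨d₁, ?_, hd₁⟩
  have h2 : d₁ * (y.den : ℤ) ^ n = d * q.den := by
    rw [hd₁, mul_assoc] at h1
    exact mul_left_cancel₀ hnum h1
  have hco2 : IsCoprime d₁ q.den :=
    (Rat.isCoprime_num_den q).of_isCoprime_of_dvd_left (hd₁ ▸ dvd_mul_left _ _)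
  exact hco2.dvd_of_dvd_mul_right (h2 ▸ dvd_mul_right _ _)

/-- Under `abc`, the abscissae of rational points on the twists have bounded height. -/
theorem ABCConjecture.exists_ratHeight_le (habc : ABCConjecture) {n : ℕ} (hn : 2 ≤ n)
    {f : ℤ[X]} (hsf : Squarefree (f.map (Int.castRingHom ℚ)))
    (hnoroot : ¬ ∃ x : ℚ, aeval x f = 0)
    (hdeg : (4 * (n : ℝ) - 2) / ((n : ℝ) - 1) < f.natDegree) :
    ∃ C θ : ℝ, 1 ≤ C ∧ 0 < θ ∧ θ < 1 / 2 ∧ ∀ X : ℝ, 1 ≤ X → ∀ d : ℤ, |(d : ℝ)| ≤ X →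
      ∀ x y : ℚ, (d : ℚ) * y ^ n = aeval x f → ratHeight x ≤ C * X ^ θ := by
  have hn1 : (0 : ℝ) < (n : ℝ) - 1 := by
    have : (2 : ℝ) ≤ n := by exact_mod_cast hn
    linarith
  have hn0 : (0 : ℝ) < n := by linarith
  set D : ℝ := (f.natDegree : ℝ) with hD
  have hδ : 0 < D * (n - 1) - (4 * n - 2) := by
    rw [div_lt_iff₀ hn1] at hdeg
    linarith
  set ε : ℝ := (D * (n - 1) - (4 * n - 2)) / (2 * n) with hεdef
  have hε : 0 < ε := by positivity
  have hεn : n * ε = (D * (n - 1) - (4 * n - 2)) / 2 := by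
    rw [hεdef]
    field_simp
  obtain ⟨C, hC, hCb⟩ := habc.ratHeight_rpow_le hsf hε
  obtain ⟨B, hB, hBb⟩ := exists_abs_num_eval_le (f.map (Int.castRingHom ℚ))
  have hfd : (f.map (Int.castRingHom ℚ)).natDegree = f.natDegree :=
    natDegree_map_eq_of_injective (RingHom.injective_int _) f
  rw [hfd] at hCb hBb
  have hev : ∀ x : ℚ, (f.map (Int.castRingHom ℚ)).eval x = aeval x f := fun x => by
    rw [eval_map, aeval_def]; rfl
  simp only [hev] at hCb hBb
  set E : ℝ := n * (D - 2 - ε) - D with hE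
  have hE2 : 2 * (n - 1) < E := by
    have h0 : E = n * D - 2 * n - n * ε - D := by rw [hE]; ring
    have h1 : D * (n - 1) = n * D - D := by ring
    rw [h0, hεn]
    linarith
  have hE0 : 0 < E := by linarith
  refine ⟨max 1 ((C ^ n * B) ^ E⁻¹), (n - 1) / E, le_max_left _ _, by positivity, ?_,
    fun X hX d hd x y hxy => ?_⟩
  · rw [div_lt_div_iff₀ hE0 two_pos]
    linarith
  have hfx : aeval x f ≠ 0 := fun h => hnoroot ⟨x, h⟩
  have hd0 : d ≠ 0 := by
    rintro rfl
    rw [Int.cast_zero, zero_mul] at hxy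
    exact hfx hxy.symm
  have hy : y ≠ 0 := by
    rintro rfl
    rw [zero_pow (by lia), mul_zero] at hxy
    exact hfx hxy.symm
  obtain ⟨d₁, hd₁, hnum⟩ := exists_num_eq_of_mul_pow_eq hy hxy
  have hH := one_le_ratHeight x
  have hd₁0 : d₁ ≠ 0 := ne_zero_of_dvd_ne_zero hd0 hd₁
  have hy0 : y.num ≠ 0 := Rat.num_ne_zero.2 hy
  have hrad : IntRadical (aeval x f).num ≤ d₁.natAbs * y.num.natAbs := by
    rw [← Int.natAbs_mul]
    refine (intRadical_le_intRadical (mul_ne_zero hd₁0 hy0) fun p hp h => ?_).trans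
      (intRadical_le_natAbs (mul_ne_zero hd₁0 hy0))
    have hp' := Nat.prime_iff_prime_int.1 hp
    rw [hnum] at h
    rcases hp'.dvd_or_dvd h with h | h
    · exact Dvd.dvd.mul_left (hp'.dvd_of_dvd_pow h) _
    · exact h.mul_right _
  have hd₁X : (d₁.natAbs : ℝ) ≤ X := by
    refine le_trans ?_ hd
    rw [Nat.cast_natAbs, Int.cast_abs]
    have := Int.le_of_dvd (abs_pos.2 hd0) ((abs_dvd_abs _ _).2 hd₁)
    exact_mod_cast this
  have h1 : (IntRadical (aeval x f).num : ℝ) ^ n ≤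
      X ^ (n - 1) * (B * ratHeight x ^ f.natDegree) := by
    calc (IntRadical (aeval x f).num : ℝ) ^ n ≤ ((d₁.natAbs * y.num.natAbs : ℕ) : ℝ) ^ n := by
          gcongr
      _ = (d₁.natAbs : ℝ) ^ (n - 1) * |((aeval x f).num : ℝ)| := by
          rw [hnum]
          push_cast
          rw [Nat.cast_natAbs, Nat.cast_natAbs, abs_mul, abs_pow, mul_pow]
          push_cast
          obtain ⟨k, rfl⟩ : ∃ k, n = k + 1 := ⟨n - 1, by lia⟩
          rw [Nat.add_sub_cancel]
          ring
      _ ≤ _ := by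
          gcongr
          exact hBb x
  have h2 : ratHeight x ^ E ≤ C ^ n * B * X ^ ((n : ℝ) - 1) := by
    have h3 := pow_le_pow_left₀ (by positivity) (hCb x hfx) n
    rw [← Real.rpow_natCast, ← Real.rpow_mul (by positivity), mul_pow] at h3
    have h4 : (0 : ℝ) < ratHeight x ^ f.natDegree := by positivity
    refine le_of_mul_le_mul_right ?_ h4
    calc _ = ratHeight x ^ ((f.natDegree - 2 - ε) * n) := by
          rw [← Real.rpow_natCast, ← Real.rpow_add (by positivity)]
          congr 1
          rw [hE]
          ring
      _ ≤ C ^ n * IntRadical (aeval x f).num ^ n := h3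
      _ ≤ C ^ n * (X ^ (n - 1) * (B * ratHeight x ^ f.natDegree)) := by gcongr
      _ = _ := by
          have h5 : (n : ℝ) - 1 = ((n - 1 : ℕ) : ℝ) := by
            rw [Nat.cast_sub (by lia), Nat.cast_one]
          rw [h5, Real.rpow_natCast]
          ring
  calc ratHeight x = (ratHeight x ^ E) ^ E⁻¹ :=
        (Real.rpow_rpow_inv (by positivity) hE0.ne').symm
    _ ≤ (C ^ n * B * X ^ ((n : ℝ) - 1)) ^ E⁻¹ := by gcongr
    _ = (C ^ n * B) ^ E⁻¹ * X ^ (((n : ℝ) - 1) / E) := by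
        rw [Real.mul_rpow (by positivity) (by positivity), ← Real.rpow_mul (by positivity),
          div_eq_mul_inv]
    _ ≤ _ := by gcongr; exact le_max_right _ _

/-- Under `abc`, few twists with a given sign have a rational point. -/
theorem ABCConjecture.exists_card_le (habc : ABCConjecture) {n : ℕ} (hn : 2 ≤ n)
    {f : ℤ[X]} (hsf : Squarefree (f.map (Int.castRingHom ℚ)))
    (hnoroot : ¬ ∃ x : ℚ, aeval x f = 0)
    (hdeg : (4 * (n : ℝ) - 2) / ((n : ℝ) - 1) < f.natDegree) :
    ∃ C θ : ℝ, 0 < C ∧ θ < 1 ∧ ∀ X : ℝ, 1 ≤ X → ∀ T : Finset ℤ,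
      (∀ d ∈ T, |(d : ℝ)| ≤ X ∧ NthPowerFree n d ∧ HasTwistPoint n f d ℚ) →
      (∀ d ∈ T, ∀ e ∈ T, 0 < d * e) → (T.card : ℝ) ≤ C * X ^ θ := by
  obtain ⟨C, θ, hC, hθ0, hθ, hb⟩ := habc.exists_ratHeight_le hn hsf hnoroot hdeg
  refine ⟨6 * C ^ 2, 2 * θ, by positivity, by linarith, fun X hX T hT hpos => ?_⟩
  have hT' : ∀ d ∈ T, ∃ x y : ℚ, (d : ℚ) * y ^ n = aeval x f := fun d hd => (hT d hd).2.2
  choose! x y hxy using hT'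
  set R : ℝ := C * X ^ θ
  have hR : 1 ≤ R := one_le_mul_of_one_le_of_one_le hC (Real.one_le_rpow hX hθ0.le)
  set N : ℕ := ⌊R⌋₊
  have hN : (N : ℝ) ≤ R := Nat.floor_le (by linarith)
  have hHx : ∀ d ∈ T, ratHeight (x d) ≤ R := fun d hd =>
    hb X hX d (hT d hd).1 (x d) (y d) (hxy d hd)
  have hcard : T.card ≤
      (Finset.Icc (-(N : ℤ)) N ×ˢ Finset.range (N + 1)).card := by
    refine Finset.card_le_card_of_injOn (fun d => ((x d).num, (x d).den)) ?_ ?_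
    · intro d hd
      have h1 := (abs_num_le_ratHeight (x d)).trans (hHx d hd)
      have h2 := (den_le_ratHeight (x d)).trans (hHx d hd)
      rw [← Int.cast_abs, ← Int.natCast_natAbs, Int.cast_natCast] at h1
      have h3 := Nat.le_floor h1
      have h4 := Nat.le_floor h2
      simp only [Finset.coe_product, Set.mem_prod, Finset.mem_coe, Finset.mem_Icc,
        Finset.mem_range]
      lia
    · intro d hd e he hde
      obtain ⟨h1, h2⟩ := Prod.mk.inj hde
      have hx : x d = x e := Rat.ext h1 h2
      have hz : y e ≠ 0 := by
        intro h0
        refine hnoroot ⟨x e, ?_⟩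
        rw [← hxy e he, h0, zero_pow (by lia), mul_zero]
      exact (hT d hd).2.1.eq_of_mul_pow_eq (hT e he).2.1 (hpos d hd e he) hz
        (by rw [hxy d hd, hxy e he, hx])
  rw [Finset.card_product, Int.card_Icc, Finset.card_range] at hcard
  have h1 : ((N : ℤ) + 1 - -(N : ℤ)).toNat = 2 * N + 1 := by lia
  rw [h1] at hcard
  have hX0 : 0 ≤ X := by linarith
  calc (T.card : ℝ) ≤ (((2 * N + 1) * (N + 1) : ℕ) : ℝ) := by exact_mod_cast hcard
    _ = (2 * N + 1) * (N + 1) := by push_cast; ring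
    _ ≤ (2 * R + 1) * (R + 1) := by gcongr
    _ ≤ 6 * R ^ 2 := by nlinarith
    _ = 6 * C ^ 2 * X ^ (2 * θ) := by
        rw [mul_pow, ← Real.rpow_natCast (X ^ θ), ← Real.rpow_mul hX0, mul_comm θ]
        push_cast
        ring

end RationalPoints

section LocalPoints

theorem exists_nthPowerFree_mul_pow {n : ℕ} (hn : n ≠ 0) (m : ℤ) (hm : m ≠ 0) :
    ∃ d y : ℤ, NthPowerFree n d ∧ y ≠ 0 ∧ m = d * y ^ n := by
  induction h : m.natAbs using Nat.strong_induction_on generalizing m with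
  | _ N ih =>
    by_cases hfree : NthPowerFree n m
    · exact ⟨m, 1, hfree, one_ne_zero, by rw [one_pow, mul_one]⟩
    · obtain ⟨p, hp, k, hk⟩ : ∃ p : ℕ, p.Prime ∧ (p : ℤ) ^ n ∣ m := by
        by_contra! h0
        exact hfree ⟨hm, h0⟩
      have hk0 : k ≠ 0 := right_ne_zero_of_mul (hk ▸ hm)
      have hlt : k.natAbs < N := by
        rw [← h, hk, Int.natAbs_mul, Int.natAbs_pow, Int.natAbs_natCast]
        exact lt_mul_of_one_lt_left (Int.natAbs_pos.2 hk0) (Nat.one_lt_pow hn hp.one_lt)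
      obtain ⟨d, y, hd, hy, hdy⟩ := ih _ hlt k hk0 rfl
      exact ⟨d, p * y, hd, mul_ne_zero (by exact_mod_cast hp.ne_zero) hy, by rw [hk, hdy]; ring⟩

theorem exists_bezout_derivative {f : ℤ[X]} (hsf : Squarefree (f.map (Int.castRingHom ℚ))) :
    ∃ (a b : ℤ[X]) (R : ℤ), R ≠ 0 ∧ a * f + b * derivative f = C R := by
  obtain ⟨a, b, hab⟩ := (PerfectField.separable_iff_squarefree.2 hsf : IsCoprime _ _)
  obtain ⟨K, hK, A, hA⟩ := exists_int_polynomial a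
  obtain ⟨L, hL, B, hB⟩ := exists_int_polynomial b
  refine ⟨C L * A, C K * B, K * L, mul_ne_zero hK hL,
    Polynomial.map_injective (Int.castRingHom ℚ) (RingHom.injective_int _) ?_⟩
  rw [derivative_map] at hab
  simp only [Polynomial.map_add, Polynomial.map_mul, map_C, hA, hB, map_mul, eq_intCast (Int.castRingHom ℚ)]
  linear_combination (C (K : ℚ) * C (L : ℚ)) * hab

/-- An integer close enough to `1` is a `p`-adic `n`-th power. -/
theorem PadicInt.exists_pow_eq_one_add (p : ℕ) [Fact p.Prime] {n : ℕ} (hn : n ≠ 0) {k : ℤ}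
    (hk : (p : ℤ) ∣ k) : ∃ r : ℤ_[p], r ^ n = ((1 + n ^ 2 * k : ℤ) : ℤ_[p]) := by
  have h : ‖aeval (1 : ℤ_[p]) (X ^ n - C (1 + n ^ 2 * k : ℤ))‖ <
      ‖aeval (1 : ℤ_[p]) (derivative (X ^ n - C (1 + n ^ 2 * k : ℤ)))‖ ^ 2 := by
    have h1 : aeval (1 : ℤ_[p]) (X ^ n - C (1 + n ^ 2 * k : ℤ)) =
        -((n : ℤ_[p]) ^ 2 * (k : ℤ_[p])) := by
      simp
    have h2 : aeval (1 : ℤ_[p]) (derivative (X ^ n - C (1 + n ^ 2 * k : ℤ))) = (n : ℤ_[p]) := by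
      rw [derivative_sub, derivative_C, derivative_X_pow]
      simp
    rw [h1, h2, norm_neg, norm_mul, norm_pow]
    exact mul_lt_of_lt_one_right (pow_pos (norm_pos_iff.2 (Nat.cast_ne_zero.2 hn)) 2)
      ((PadicInt.norm_int_lt_one_iff_dvd k).2 hk)
  obtain ⟨r, hr, -⟩ := hensels_lemma h
  refine ⟨r, ?_⟩
  rw [map_sub, map_pow, aeval_X, aeval_C, sub_eq_zero] at hr
  rw [hr, algebraMap_int_eq, eq_intCast]

/-- A root modulo `p` lifts to a `p`-adic root when `p` does not divide the discriminant. -/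
theorem PadicInt.exists_aeval_eq_zero (p : ℕ) [Fact p.Prime] {f a b : ℤ[X]} {R : ℤ}
    (hab : a * f + b * derivative f = C R) (hp : ¬ (p : ℤ) ∣ R)
    (hroot : ∃ x : ZMod p, aeval x f = 0) : ∃ x : ℤ_[p], aeval x f = 0 := by
  obtain ⟨x, hx⟩ := hroot
  obtain ⟨m, rfl⟩ := ZMod.intCast_surjective x
  rw [aeval_intCast_eq, ZMod.intCast_zmod_eq_zero_iff_dvd] at hx
  have hd : ¬ (p : ℤ) ∣ (derivative f).eval m := by
    intro h
    have := congrArg (eval m) hab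
    rw [eval_add, eval_mul, eval_mul, eval_C] at this
    exact hp (this ▸ dvd_add (hx.mul_left _) (h.mul_left _))
  have h : ‖aeval ((m : ℤ) : ℤ_[p]) f‖ < ‖aeval ((m : ℤ) : ℤ_[p]) (derivative f)‖ ^ 2 := by
    rw [aeval_intCast_eq, aeval_intCast_eq]
    have h1 : ‖(((derivative f).eval m : ℤ) : ℤ_[p])‖ = 1 :=
      le_antisymm (PadicInt.norm_le_one _)
        (not_lt.1 fun h => hd ((PadicInt.norm_int_lt_one_iff_dvd _).1 h))
    rw [h1, one_pow]
    exact (PadicInt.norm_int_lt_one_iff_dvd _).2 hx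
  obtain ⟨r, hr, -⟩ := hensels_lemma h
  exact ⟨r, hr⟩

theorem hasTwistPoint_of_pow_eq {K : Type} [Field K] [CharZero K] {n : ℕ} {f : ℤ[X]} {d y t : ℤ}
    (hf : f.eval 0 = d * y ^ n) (ht : t ≠ 0) {r : K} (hr : r ^ n = t) :
    HasTwistPoint n f (d * t) K := by
  refine ⟨0, y / r, ?_⟩
  have h0 := aeval_intCast_eq (S := K) f 0
  rw [Int.cast_zero] at h0
  have ht' : (t : K) ≠ 0 := Int.cast_ne_zero.2 ht
  rw [h0, hf, div_pow, hr]
  push_cast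
  field_simp

/-- A family of everywhere locally soluble twists: an arithmetic progression. -/
theorem WeaklyIntersective.exists_everywhereLocallySoluble {n : ℕ} (hn : n ≠ 0) {f : ℤ[X]}
    (hwi : WeaklyIntersective f) (hsf : Squarefree (f.map (Int.castRingHom ℚ)))
    (hf0 : f.eval 0 ≠ 0) (hdeg : 1 ≤ f.natDegree) :
    ∃ (d : ℤ) (W : ℕ), NthPowerFree n d ∧ 0 < W ∧ 2 ∣ W ∧ d ∣ W ∧
      ∀ z : ℕ, EverywhereLocallySoluble n f (d * (1 + W * z)) := by
  obtain ⟨d, y, hd, hy, hdy⟩ := exists_nthPowerFree_mul_pow hn _ hf0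
  obtain ⟨a, b, R, hR, hab⟩ := exists_bezout_derivative hsf
  obtain ⟨S, hS⟩ := hwi.exists_root hdeg
  set M : ℕ := 2 * d.natAbs * R.natAbs * ∏ p ∈ S, (p : ℕ) with hM
  have hM0 : M ≠ 0 := by
    have h1 : ∏ p ∈ S, (p : ℕ) ≠ 0 := Finset.prod_ne_zero_iff.2 fun p _ => p.2.ne_zero
    have h2 := Int.natAbs_ne_zero.2 hd.1
    have h3 := Int.natAbs_ne_zero.2 hR
    positivity
  have hdM : d ∣ M := Int.dvd_natCast.2 (Dvd.intro_left 2 rfl |>.mul_right _ |>.mul_right _)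
  refine ⟨d, n ^ 2 * M, hd, by positivity, ?_, ?_, fun z => ⟨?_, fun p _ => ?_⟩⟩
  · exact ((Dvd.intro _ rfl).mul_right _ |>.mul_right _).mul_left _
  · push_cast
    exact hdM.mul_left _
  · refine hasTwistPoint_of_pow_eq hdy (by positivity)
      (Real.rpow_inv_natCast_pow ?_ hn)
    positivity
  · by_cases hp : p ∣ M
    · obtain ⟨r, hr⟩ := PadicInt.exists_pow_eq_one_add p hn (k := M * z)
        ((Int.natCast_dvd_natCast.2 hp).mul_right _)
      refine hasTwistPoint_of_pow_eq hdy (by positivity) (r := (r : ℚ_[p])) ?_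
      rw [← PadicInt.coe_pow, hr, PadicInt.coe_intCast]
      push_cast
      ring
    · have hpS : (⟨p, Fact.out⟩ : Nat.Primes) ∉ S := fun h =>
        hp ((Finset.dvd_prod_of_mem (fun q : Nat.Primes => (q : ℕ)) h).mul_left _)
      have hpR : ¬ (p : ℤ) ∣ R := fun h =>
        hp (((Int.natCast_dvd.1 h).mul_left _).mul_right _)
      obtain ⟨x, hx⟩ := PadicInt.exists_aeval_eq_zero p hab hpR (hS _ hpS)
      refine ⟨(x : ℚ_[p]), 0, ?_⟩
      have h := aeval_algebraMap_apply ℚ_[p] x f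
      rw [hx, map_zero] at h
      rw [zero_pow hn, mul_zero]
      exact h.symm

end LocalPoints

section SquarefreeProgression

theorem card_filter_sq_dvd_le {W k : ℕ} (hkW : Nat.Coprime k W) (Z : ℕ) :
    ({z ∈ Finset.Icc 1 Z | k ^ 2 ∣ 1 + W * z}).card ≤ Z / k ^ 2 + 1 := by
  rw [← Finset.card_range (Z / k ^ 2 + 1)]
  refine Finset.card_le_card_of_injOn (fun z => z / k ^ 2) ?_ ?_
  · intro z hz
    rw [Finset.mem_coe, Finset.mem_filter, Finset.mem_Icc] at hz
    rw [Finset.mem_coe, Finset.mem_range, Nat.lt_succ_iff]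
    exact Nat.div_le_div_right hz.1.2
  · intro z hz z' hz' h
    rw [Finset.mem_coe, Finset.mem_filter] at hz hz'
    have h1 : 1 + W * z ≡ 1 + W * z' [MOD k ^ 2] :=
      ((Nat.modEq_zero_iff_dvd).2 hz.2).trans ((Nat.modEq_zero_iff_dvd).2 hz'.2).symm
    have h2 : z ≡ z' [MOD k ^ 2] :=
      Nat.ModEq.cancel_left_of_coprime (Nat.Coprime.pow_left 2 hkW)
        (Nat.ModEq.add_left_cancel' 1 h1)
    have h3 : z / k ^ 2 = z' / k ^ 2 := h
    rw [← Nat.div_add_mod z (k ^ 2), ← Nat.div_add_mod z' (k ^ 2), h3, h2]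

theorem card_filter_not_squarefree_le {W : ℕ} (hW : 2 ∣ W) (Z : ℕ) :
    (({z ∈ Finset.Icc 1 Z | ¬ Squarefree (1 + W * z)}).card : ℝ) ≤
      Z / 2 + √(1 + W * Z) := by
  classical
  set K : ℕ := Nat.sqrt (1 + W * Z)
  have hsub : ({z ∈ Finset.Icc 1 Z | ¬ Squarefree (1 + W * z)}) ⊆
      ({k ∈ Finset.Ioc 2 K | Nat.Coprime k W}).biUnion
        fun k => {z ∈ Finset.Icc 1 Z | k ^ 2 ∣ 1 + W * z} := by
    intro z hz
    rw [Finset.mem_filter, Nat.squarefree_iff_prime_squarefree] at hz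
    push Not at hz
    obtain ⟨hz, p, hp, hpz⟩ := hz
    have hcop : Nat.Coprime p W := by
      refine (Nat.Prime.coprime_iff_not_dvd hp).2 fun h => hp.one_lt.ne' ?_
      exact Nat.dvd_one.1 ((Nat.dvd_add_left (h.mul_right z)).1 ((Dvd.intro _ rfl).trans hpz))
    have hp2 : p ≠ 2 := by
      rintro rfl
      exact absurd (Nat.eq_one_of_dvd_coprimes hcop dvd_rfl hW) (by decide)
    rw [Finset.mem_biUnion]
    refine ⟨p, ?_, ?_⟩
    · have := hp.two_le
      refine Finset.mem_filter.2 ⟨Finset.mem_Ioc.2 ⟨by lia, Nat.le_sqrt.2 ?_⟩, hcop⟩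
      refine (Nat.le_of_dvd (by positivity) hpz).trans ?_
      have := (Finset.mem_Icc.1 hz).2
      gcongr
    · rw [Finset.mem_filter, sq]
      exact ⟨hz, hpz⟩
  have hinv : ∑ k ∈ Finset.Ioc 2 K, ((k : ℝ) ^ 2)⁻¹ ≤ 1 / 2 := by
    rcases le_total 2 K with h | h
    · refine (sum_Ioc_inv_sq_le_sub two_ne_zero h).trans ?_
      have : (0 : ℝ) ≤ (K : ℝ)⁻¹ := by positivity
      push_cast
      linarith
    · rw [Finset.Ioc_eq_empty_of_le h, Finset.sum_empty]
      positivity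
  calc _ ≤ ((∑ k ∈ Finset.Ioc 2 K with Nat.Coprime k W,
        ({z ∈ Finset.Icc 1 Z | k ^ 2 ∣ 1 + W * z}).card : ℕ) : ℝ) := by
        exact_mod_cast (Finset.card_le_card hsub).trans Finset.card_biUnion_le
    _ ≤ ∑ k ∈ Finset.Ioc 2 K with Nat.Coprime k W, ((Z : ℝ) * ((k : ℝ) ^ 2)⁻¹ + 1) := by
        rw [Nat.cast_sum]
        refine Finset.sum_le_sum fun k hk => ?_
        rw [Finset.mem_filter, Finset.mem_Ioc] at hk
        have h1 : ((_ : ℕ) : ℝ) ≤ _ := Nat.cast_le.2 (card_filter_sq_dvd_le hk.2 Z)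
        refine h1.trans ?_
        have h2 : ((Z / k ^ 2 : ℕ) : ℝ) ≤ (Z : ℝ) / ((k ^ 2 : ℕ) : ℝ) := Nat.cast_div_le
        push_cast at h2 ⊢
        rw [← div_eq_mul_inv]
        linarith
    _ ≤ ∑ k ∈ Finset.Ioc 2 K, ((Z : ℝ) * ((k : ℝ) ^ 2)⁻¹ + 1) :=
        Finset.sum_le_sum_of_subset_of_nonneg (Finset.filter_subset _ _)
          fun _ _ _ => by positivity
    _ ≤ (Z : ℝ) * (1 / 2) + K := by
        rw [Finset.sum_add_distrib, ← Finset.mul_sum, Finset.sum_const, Nat.card_Ioc, nsmul_one]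
        have : ((K - 2 : ℕ) : ℝ) ≤ K := Nat.cast_le.2 (Nat.sub_le _ _)
        gcongr
    _ ≤ _ := by
        have h : (K : ℝ) ≤ √(1 + W * Z) := by
          refine Real.le_sqrt_of_sq_le ?_
          exact_mod_cast Nat.sqrt_le' (1 + W * Z)
        linarith

theorem NthPowerFree.mul_squarefree {n : ℕ} (hn : 2 ≤ n) {d : ℤ} {W t : ℕ}
    (hd : NthPowerFree n d) (hdW : d ∣ W) (ht : Nat.Coprime t W) (hsq : Squarefree t) :
    NthPowerFree n (d * t) := by
  refine ⟨mul_ne_zero hd.1 (by exact_mod_cast hsq.ne_zero), fun p hp h => ?_⟩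
  have hp' := Nat.prime_iff_prime_int.1 hp
  by_cases hpt : p ∣ t
  · have hpd : ¬ (p : ℤ) ∣ d := fun h1 =>
      hp.one_lt.ne' (Nat.eq_one_of_dvd_coprimes ht hpt (Int.natCast_dvd_natCast.1 (h1.trans hdW)))
    have h1 := hp'.pow_dvd_of_dvd_mul_left n hpd h
    have h2 : p * p ∣ t := by
      rw [← sq]
      exact (pow_dvd_pow p hn).trans (by exact_mod_cast h1)
    exact hp.one_lt.ne' (Nat.isUnit_iff.1 (hsq p h2))
  · exact hd.2 p hp (hp'.pow_dvd_of_dvd_mul_right n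
      (fun h1 => hpt (Int.natCast_dvd_natCast.1 h1)) h)

end SquarefreeProgression

theorem eventually_add_sqrt_add_rpow_le (a b C : ℝ) {θ ε : ℝ} (hθ : θ < 1) (hε : 0 < ε) :
    ∀ᶠ X : ℝ in Filter.atTop, a + b * √X + C * X ^ θ ≤ ε * X := by
  have h1 := (((tendsto_rpow_neg_atTop zero_lt_one).const_mul a).add
    ((tendsto_rpow_neg_atTop one_half_pos).const_mul b)).add
    ((tendsto_rpow_neg_atTop (sub_pos.2 hθ)).const_mul C)
  rw [mul_zero, mul_zero, mul_zero, add_zero, add_zero] at h1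
  filter_upwards [h1.eventually_le_const hε, Filter.eventually_gt_atTop 0] with X hX hX0
  refine le_trans (le_of_eq ?_) (mul_le_mul_of_nonneg_right hX hX0.le)
  have h (s : ℝ) : X ^ s * X = X ^ (s + 1) := by
    rw [Real.rpow_add hX0, Real.rpow_one]
  rw [add_mul, add_mul, mul_assoc, mul_assoc, mul_assoc, h, h, h, Real.sqrt_eq_rpow]
  norm_num

/-- Assuming the abc conjecture, for a weakly intersective squarefree `f` with
no rational root and large degree, a positive proportion of the twists
`d·y^n = f(x)` violate the Hasse principle. -/
theorem stmt_8 (habc : ABCConjecture) (n : ℕ) (hn : 2 ≤ n) (f : Polynomial ℤ)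
    (hsf : Squarefree (f.map (Int.castRingHom ℚ))) (hwi : WeaklyIntersective f)
    (hnoroot : ¬ ∃ x : ℚ, Polynomial.aeval x f = 0)
    (hdeg5 : 5 < f.natDegree)
    (hdeg : (4 * (n : ℝ) - 2) / ((n : ℝ) - 1) < f.natDegree) :
    ∃ c : ℝ, 0 < c ∧ ∃ X₀ : ℝ, ∀ X : ℝ, X₀ ≤ X →
      c * X ≤
        ({d : ℤ | |(d : ℝ)| ≤ X ∧ NthPowerFree n d ∧ ViolatesHasse n f d}.ncard : ℝ) := by
  classical
  have hf0 : f.eval 0 ≠ 0 := by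
    intro h
    refine hnoroot ⟨0, ?_⟩
    have h0 := aeval_intCast_eq (S := ℚ) f 0
    rwa [h, Int.cast_zero] at h0
  obtain ⟨d, W, hd, hW, hW2, hdW, hloc⟩ :=
    hwi.exists_everywhereLocallySoluble (by lia : n ≠ 0) hsf hf0 (by lia)
  obtain ⟨C, θ, -, hθ, hcount⟩ := habc.exists_card_le hn hsf hnoroot hdeg
  set A : ℝ := |(d : ℝ)| * (1 + W)
  have hd0 : 0 < |(d : ℝ)| := abs_pos.2 (Int.cast_ne_zero.2 hd.1)
  have hd1 : 1 ≤ |(d : ℝ)| := by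
    have := Int.one_le_abs hd.1
    exact_mod_cast this
  have hA : 0 < A := by positivity
  obtain ⟨X₀, hX₀⟩ := Filter.eventually_atTop.1
    ((eventually_add_sqrt_add_rpow_le (1 / 2) (√(1 + W)) C hθ
      (by positivity : 0 < 1 / (4 * A))).and (Filter.eventually_ge_atTop 1))
  refine ⟨1 / (4 * A), by positivity, X₀, fun X hX => ?_⟩
  obtain ⟨hbound, hX1⟩ := hX₀ X hX
  set Z : ℕ := ⌊X / A⌋₊
  have hZ : (Z : ℝ) ≤ X / A := Nat.floor_le (by positivity)
  have hZ' : X / A < Z + 1 := Nat.lt_floor_add_one _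
  set G : Finset ℕ := {z ∈ Finset.Icc 1 Z | Squarefree (1 + W * z)}
  set g : ℕ → ℤ := fun z => d * (1 + W * z)
  have hg : Function.Injective g := by
    intro z z' h
    have h1 := mul_left_cancel₀ hd.1 h
    have h2 : 1 + W * z = 1 + W * z' := by exact_mod_cast h1
    exact Nat.eq_of_mul_eq_mul_left hW (Nat.add_left_cancel h2)
  have hG : (Z : ℝ) / 2 - √(1 + W * Z) ≤ G.card := by
    have h1 := Finset.card_filter_add_card_filter_not (s := Finset.Icc 1 Z)
      (fun z => Squarefree (1 + W * z))
    rw [Nat.card_Icc, Nat.add_sub_cancel] at h1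
    have h2 := card_filter_not_squarefree_le hW2 Z
    have h3 : (G.card : ℝ) + ({z ∈ Finset.Icc 1 Z | ¬ Squarefree (1 + W * z)}).card = Z := by
      exact_mod_cast h1
    linarith
  have hsmall : ∀ e ∈ G.image g, |(e : ℝ)| ≤ X ∧ NthPowerFree n e := by
    intro e he
    obtain ⟨z, hz, rfl⟩ := Finset.mem_image.1 he
    rw [Finset.mem_filter, Finset.mem_Icc] at hz
    constructor
    · have h1 : (1 : ℝ) ≤ z := by exact_mod_cast hz.1.1
      have h2 : (z : ℝ) ≤ Z := by exact_mod_cast hz.1.2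
      have h3 : (z : ℝ) ≤ X / A := h2.trans hZ
      rw [le_div_iff₀ hA] at h3
      refine le_trans ?_ h3
      simp only [g]
      push_cast
      rw [abs_mul, abs_of_nonneg (by positivity : (0 : ℝ) ≤ 1 + W * z)]
      calc |(d : ℝ)| * (1 + W * z) ≤ |(d : ℝ)| * (z + W * z) := by gcongr
        _ = z * A := by ring
    · have hco : Nat.Coprime (1 + W * z) W := by simp
      have h1 := hd.mul_squarefree hn hdW hco hz.2
      push_cast at h1
      exact h1
  set T : Finset ℤ := {e ∈ G.image g | HasTwistPoint n f e ℚ}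
  have hT : (T.card : ℝ) ≤ C * X ^ θ := by
    refine hcount X hX1 T (fun e he => ?_) (fun e he e' he' => ?_)
    · obtain ⟨h1, h2⟩ := Finset.mem_filter.1 he
      exact ⟨(hsmall e h1).1, (hsmall e h1).2, h2⟩
    · obtain ⟨z, -, rfl⟩ := Finset.mem_image.1 (Finset.mem_filter.1 he).1
      obtain ⟨z', -, rfl⟩ := Finset.mem_image.1 (Finset.mem_filter.1 he').1
      have h1 := mul_self_pos.2 hd.1
      calc 0 < d * d * ((1 + W * z) * (1 + W * z')) := by positivity
        _ = g z * g z' := by ring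
  set U : Finset ℤ := {e ∈ G.image g | ¬ HasTwistPoint n f e ℚ}
  have hTU : (G.card : ℝ) = T.card + U.card := by
    have h1 := Finset.card_filter_add_card_filter_not (s := G.image g)
      (fun e => HasTwistPoint n f e ℚ)
    rw [Finset.card_image_of_injective _ hg] at h1
    exact_mod_cast h1.symm
  have hU : (U.card : ℝ) ≤
      ({d : ℤ | |(d : ℝ)| ≤ X ∧ NthPowerFree n d ∧ ViolatesHasse n f d}.ncard : ℝ) := by
    rw [← Set.ncard_coe_finset, Nat.cast_le]
    refine Set.ncard_le_ncard (fun e he => ?_) ?_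
    · obtain ⟨h1, h2⟩ := Finset.mem_filter.1 (Finset.mem_coe.1 he)
      refine ⟨(hsmall e h1).1, (hsmall e h1).2, ?_, h2⟩
      obtain ⟨z, -, rfl⟩ := Finset.mem_image.1 h1
      exact hloc z
    · refine (Set.finite_Icc (-⌊X⌋) ⌊X⌋).subset fun e he => ?_
      obtain ⟨h1, h2⟩ := abs_le.1 he.1
      refine ⟨?_, Int.le_floor.2 h2⟩
      rw [neg_le, Int.le_floor]
      push_cast
      linarith
  have hsqrt : √(1 + W * Z) ≤ √(1 + W) * √X := by
    rw [← Real.sqrt_mul (by positivity)]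
    refine Real.sqrt_le_sqrt ?_
    have h1 : 1 ≤ A := one_le_mul_of_one_le_of_one_le hd1 (by simp)
    have h2 : (Z : ℝ) ≤ X := hZ.trans (div_le_self (by linarith) h1)
    calc (1 : ℝ) + W * Z ≤ X + W * X := by gcongr
      _ = _ := by ring
  have h4 : X / A = 4 * (1 / (4 * A) * X) := by field_simp
  linarith
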